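/- Let P be a holomorphic polynomial on ℂ² and let M := { (z₁,z₂) ∈ ℂ² : |P(z₁,z₂)| = 1 } with dP(z) ≠ 0 for all z ∈ M. Let K ⊂ M be a compact, simply-coconnected set. If P⁻¹{c} ∩ K is polynomially convex for every c in the unit circle ∂𝔻, then K is polynomially convex. -/

import Mathlib

noncomputable section

/-- The polynomial (convex) hull of a set `K ⊆ ℂⁿ`:
`K̂ = { z : |p(z)| ≤ sup_K |p| for every holomorphic polynomial p }`. -/
def polyHull (n : ℕ) (K : Set (Fin n → ℂ)) : Set (Fin n → ℂ) :=
  {z | ∀ p : MvPolynomial (Fin n) ℂ,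
    ‖MvPolynomial.eval z p‖ ≤ sSup ((fun w => ‖MvPolynomial.eval w p‖) '' K)}

/-- A set `K ⊆ ℂⁿ` is polynomially convex if it equals its polynomial hull. -/
def PolyConvex (n : ℕ) (K : Set (Fin n → ℂ)) : Prop := polyHull n K = K

/-- A Runge domain in `ℂⁿ`: a domain on which every holomorphic function can be
approximated uniformly on compact subsets by holomorphic polynomials. -/
def RungeDomain (n : ℕ) (Ω : Set (Fin n → ℂ)) : Prop :=
  IsOpen Ω ∧ IsConnected Ω ∧
  ∀ f : (Fin n → ℂ) → ℂ, DifferentiableOn ℂ f Ω →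
    ∀ K : Set (Fin n → ℂ), K ⊆ Ω → IsCompact K → ∀ ε : ℝ, 0 < ε →
      ∃ p : MvPolynomial (Fin n) ℂ, ∀ z ∈ K, ‖f z - MvPolynomial.eval z p‖ ≤ ε

/-- `K ⊆ ℂⁿ` is a totally real `C²`-smooth disc: the image of the closed unit
disc in `ℝ²` under a `C²` embedding `φ` (defined on an open neighborhood `U` of
the closed disc) whose image is a totally real submanifold, i.e. at each point
the tangent plane `W = range (dφ)` satisfies `W ∩ i·W = {0}`. -/
def TotallyRealDisc (n : ℕ) (K : Set (Fin n → ℂ)) : Prop :=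
  ∃ (U : Set (ℝ × ℝ)) (φ : ℝ × ℝ → (Fin n → ℂ)),
    IsOpen U ∧ Metric.closedBall (0 : ℝ × ℝ) 1 ⊆ U ∧
    ContDiffOn ℝ 2 φ U ∧ Set.InjOn φ U ∧
    (∀ x ∈ U, Function.Injective (fderiv ℝ φ x)) ∧
    (∀ x ∈ U, ∀ v w : ℝ × ℝ,
      fderiv ℝ φ x v = Complex.I • fderiv ℝ φ x w → fderiv ℝ φ x v = 0) ∧
    K = φ '' Metric.closedBall (0 : ℝ × ℝ) 1

/-- A compact set `K ⊆ ℂⁿ` is simply-coconnected if every continuous nowhere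
vanishing `f : K → ℂ ∖ {0}` has a continuous logarithm on `K`. -/
def SimplyCoconnected (n : ℕ) (K : Set (Fin n → ℂ)) : Prop :=
  ∀ f : (Fin n → ℂ) → ℂ, ContinuousOn f K → (∀ x ∈ K, f x ≠ 0) →
    ∃ ψ : (Fin n → ℂ) → ℂ, ContinuousOn ψ K ∧ ∀ x ∈ K, f x = Complex.exp (ψ x)

section Helpers

/-- The directional Cauchy-Riemann derivative `½ (D_v + i D_{iv}) u`. -/
def dbarDir {E : Type*} [NormedAddCommGroup E] [NormedSpace ℂ E] (v : E) (u : E → ℂ) (x : E) : ℂ :=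
  (fderiv ℝ u x v + Complex.I * fderiv ℝ u x (Complex.I • v)) / 2

open MeasureTheory Set

lemma clm_apply_eq_re_im (L : ℂ →L[ℝ] ℂ) (w : ℂ) :
    L w = w.re * L 1 + w.im * L Complex.I := by
  have h : w = w.re • (1 : ℂ) + w.im • Complex.I := by
    simp [Complex.re_add_im]
  conv_lhs => rw [h]
  rw [map_add, map_smul, map_smul, Complex.real_smul, Complex.real_smul]

lemma integral_dbarDir_div_self {f : ℂ → ℂ} (hf : ContDiff ℝ 1 f) (hc : HasCompactSupport f) :
    ∫ ζ, dbarDir 1 f ζ / ζ = -Real.pi * f 0 := by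
  obtain ⟨R, hR0, hR⟩ : ∃ R : ℝ, 0 < R ∧ ∀ ζ : ℂ, R < ‖ζ‖ → fderiv ℝ f ζ = 0 := by
    obtain ⟨R, hR0, hR⟩ := (hc.fderiv (𝕜 := ℝ)).isCompact.isBounded.exists_pos_norm_le
    refine ⟨R, hR0, fun ζ hζ => ?_⟩
    by_contra h
    exact absurd (hR ζ (subset_tsupport _ h)) (not_le.2 hζ)
  have hfd : Continuous (fderiv ℝ f) := hf.continuous_fderiv (by simp)
  set e : ℝ → ℂ := fun t => Complex.exp (t * Complex.I) with he
  have hec : Continuous e := by fun_prop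
  have hen : ∀ t, ‖e t‖ = 1 := fun t => Complex.norm_exp_ofReal_mul_I t
  set T : Set (ℝ × ℝ) := Ioi 0 ×ˢ Ioo (-Real.pi) Real.pi with hT
  have hTm : MeasurableSet T := measurableSet_Ioi.prod measurableSet_Ioo
  have hint : ∀ v : ℝ → ℂ, Continuous v →
      IntegrableOn (fun p : ℝ × ℝ => fderiv ℝ f (p.1 * e p.2) (v p.2)) T volume := by
    intro v hv
    have h1 : IntegrableOn (fun p : ℝ × ℝ => fderiv ℝ f (p.1 * e p.2) (v p.2))
        (Icc 0 R ×ˢ Icc (-Real.pi) Real.pi) volume := by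
      apply ContinuousOn.integrableOn_compact (isCompact_Icc.prod isCompact_Icc)
      apply Continuous.continuousOn
      apply Continuous.clm_apply
      · exact hfd.comp (by fun_prop)
      · fun_prop
    refine h1.of_forall_sdiff_eq_zero hTm ?_
    rintro ⟨r, t⟩ ⟨⟨hr, ht⟩, h2⟩
    have hr' : R < r := by
      by_contra h
      exact h2 ⟨⟨le_of_lt hr, not_lt.1 h⟩, ⟨ht.1.le, ht.2.le⟩⟩
    have : R < ‖(r : ℂ) * e t‖ := by
      rw [norm_mul, hen, mul_one, Complex.norm_real, Real.norm_eq_abs, abs_of_pos hr]; exact hr'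
    simp only [hR _ this]; rfl
  have hderiv : ∀ r t : ℝ, HasDerivAt (fun s : ℝ => f (s * e t)) (fderiv ℝ f (r * e t) (e t)) r := by
    intro r t
    have h1 : HasDerivAt (fun s : ℝ => (s : ℂ) * e t) (e t) r := by
      simpa using (Complex.ofRealCLM.hasDerivAt (x := r)).mul_const (e t)
    exact ((hf.differentiable (by simp)) _).hasFDerivAt.comp_hasDerivAt r h1
  have hderiv' : ∀ r t : ℝ, HasDerivAt (fun s : ℝ => f (r * e s))
      (r * fderiv ℝ f (r * e t) (Complex.I * e t)) t := by
    intro r t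
    have h0 : HasDerivAt e (Complex.I * e t) t := by
      have := ((Complex.ofRealCLM.hasDerivAt (x := t)).mul_const Complex.I).cexp
      refine this.congr_deriv ?_
      change e t * (((1:ℝ):ℂ) * Complex.I) = Complex.I * e t
      push_cast; ring
    have h1 : HasDerivAt (fun s : ℝ => (r : ℂ) * e s) (r * (Complex.I * e t)) t := h0.const_mul _
    have h2 := ((hf.differentiable (by simp)) (r * e t)).hasFDerivAt.comp_hasDerivAt t h1
    rw [← Complex.real_smul (x := r) (z := Complex.I * e t), map_smul, Complex.real_smul] at h2
    exact h2
  have hA : ∫ p in T, fderiv ℝ f (p.1 * e p.2) (e p.2) = -(2 * Real.pi) * f 0 := by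
    rw [Measure.volume_eq_prod, hT, ← setIntegral_prod_swap, setIntegral_prod]
    · have : ∀ t : ℝ, ∫ r in Ioi (0:ℝ), fderiv ℝ f (r * e t) (e t) = - f 0 := by
        intro t
        have hcs : HasCompactSupport (fun s : ℝ => f (s * e t)) := by
          refine hc.comp_isClosedEmbedding ?_
          apply Isometry.isClosedEmbedding
          refine Isometry.of_dist_eq fun x y => ?_
          rw [dist_eq_norm, ← sub_mul, norm_mul, hen, mul_one, ← Complex.ofReal_sub,
            Complex.norm_real, Real.dist_eq, Real.norm_eq_abs]
        have := HasCompactSupport.integral_Ioi_deriv_eq (f := fun s : ℝ => f (s * e t))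
          (by apply hf.comp; apply ContDiff.mul; exact Complex.ofRealCLM.contDiff; exact contDiff_const) hcs 0
        simp only [fun r => (hderiv r t).deriv] at this
        simpa using this
      simp only [Prod.swap, this]
      simp [integral_const, Real.pi_pos.le]
      left; ring
    · have := hint e hec
      rw [hT, Measure.volume_eq_prod] at this
      exact this.swap
  have hB : ∫ p in T, fderiv ℝ f (p.1 * e p.2) (Complex.I * e p.2) = 0 := by
    have hi := hint (fun t => Complex.I * e t) (by fun_prop)
    rw [Measure.volume_eq_prod, hT] at hi ⊢
    rw [setIntegral_prod _ hi]
    apply setIntegral_eq_zero_of_forall_eq_zero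
    intro r hr
    have hr : (0:ℝ) < r := hr
    have h1 : ∫ t in (-Real.pi)..Real.pi, (r * fderiv ℝ f (r * e t) (Complex.I * e t)) = 0 := by
      rw [intervalIntegral.integral_eq_sub_of_hasDerivAt (fun t _ => hderiv' r t)]
      · have : e (-Real.pi) = e Real.pi := by
          simp [he, Complex.exp_neg]
        rw [this, sub_self]
      · apply Continuous.intervalIntegrable
        apply continuous_const.mul
        apply Continuous.clm_apply
        · exact hfd.comp (by fun_prop)
        · fun_prop
    rw [intervalIntegral.integral_of_le (by linarith [Real.pi_pos]), ← integral_Ioc_eq_integral_Ioo.symm,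
      integral_const_mul] at h1
    have : (r:ℂ) ≠ 0 := by exact_mod_cast hr.ne'
    simpa [this] using h1
  rw [← Complex.integral_comp_polarCoord_symm]
  have hpt : ∀ p ∈ T, p.1 • (dbarDir 1 f (Complex.polarCoord.symm p) / Complex.polarCoord.symm p) =
      (1/2 : ℂ) * fderiv ℝ f (p.1 * e p.2) (e p.2) +
      (Complex.I / 2) * fderiv ℝ f (p.1 * e p.2) (Complex.I * e p.2) := by
    rintro ⟨r, t⟩ ⟨hr, -⟩
    have hr : (0:ℝ) < r := hr
    have hr' : (r:ℂ) ≠ 0 := by exact_mod_cast hr.ne'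
    have hpe : Complex.polarCoord.symm (r, t) = r * e t := by
      rw [Complex.polarCoord_symm_apply, he]
      simp [Complex.exp_mul_I]
    rw [hpe]
    simp only
    rw [clm_apply_eq_re_im _ (e t), clm_apply_eq_re_im _ (Complex.I * e t), dbarDir, smul_eq_mul, mul_one]
    have h1 : e t ≠ 0 := by intro h; have := hen t; simp [h] at this
    have h2 : (e t).re * (e t).re + (e t).im * (e t).im = 1 := by
      have := Complex.sq_norm (e t)
      rw [hen, Complex.normSq_apply] at this
      linarith
    have h3 : (e t)⁻¹ = (e t).re - (e t).im * Complex.I := by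
      refine inv_eq_of_mul_eq_one_right ?_
      apply Complex.ext
      · simp; linarith
      · simp; ring
    rw [Complex.real_smul, div_eq_mul_inv, mul_inv, h3]
    simp only [Complex.mul_re, Complex.mul_im, Complex.I_re, Complex.I_im]
    push_cast
    field_simp
    ring_nf
    simp only [Complex.I_sq]
    ring
  have : polarCoord.target = T := rfl
  rw [this, setIntegral_congr_fun hTm hpt, integral_add, integral_const_mul, integral_const_mul, hA, hB]
  · ring
  · exact (hint e hec).const_mul _
  · exact (hint (fun t => Complex.I * e t) (by fun_prop)).const_mul _

lemma integral_dbarDir_div_sub {f : ℂ → ℂ} (hf : ContDiff ℝ 1 f) (hc : HasCompactSupport f) (z : ℂ) :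
    ∫ ζ, dbarDir 1 f ζ / (ζ - z) = -Real.pi * f z := by
  have h := integral_dbarDir_div_self (f := fun ζ => f (ζ + z)) (by fun_prop)
    (hc.comp_homeomorph (Homeomorph.addRight z))
  rw [← integral_add_right_eq_self _ z]
  simp only [zero_add] at h
  rw [← h]
  congr 1
  ext ζ
  simp [dbarDir, fderiv_comp_add_right]

section dbarDir
variable {E : Type*} [NormedAddCommGroup E] [NormedSpace ℂ E]

lemma dbarDir_congr {v x : E} {f g : E → ℂ} (h : f =ᶠ[nhds x] g) :
    dbarDir v f x = dbarDir v g x := by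
  simp only [dbarDir, h.fderiv_eq]

lemma dbarDir_of_fderiv_eq_zero {v x : E} {f : E → ℂ} (h : fderiv ℝ f x = 0) :
    dbarDir v f x = 0 := by
  simp [dbarDir, h]

lemma dbarDir_of_differentiableAt {v x : E} {f : E → ℂ} (h : DifferentiableAt ℂ f x) :
    dbarDir v f x = 0 := by
  have h' : fderiv ℝ f x = (fderiv ℂ f x).restrictScalars ℝ :=
    (h.hasFDerivAt.restrictScalars ℝ).fderiv
  simp only [dbarDir, h', ContinuousLinearMap.coe_restrictScalars', map_smul, smul_eq_mul,
    ← mul_assoc, Complex.I_mul_I]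
  ring

lemma dbarDir_mul {v x : E} {f g : E → ℂ} (hf : DifferentiableAt ℝ f x)
    (hg : DifferentiableAt ℝ g x) :
    dbarDir v (fun y => f y * g y) x = f x * dbarDir v g x + g x * dbarDir v f x := by
  simp only [dbarDir, fderiv_fun_mul hf hg, _root_.add_apply,
    _root_.smul_apply, smul_eq_mul]
  ring

lemma dbarDir_add {v x : E} {f g : E → ℂ} (hf : DifferentiableAt ℝ f x)
    (hg : DifferentiableAt ℝ g x) :
    dbarDir v (fun y => f y + g y) x = dbarDir v f x + dbarDir v g x := by
  simp only [dbarDir, fderiv_fun_add hf hg, _root_.add_apply]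
  ring

open scoped ContDiff in
lemma ContDiff.dbarDir {f : E → ℂ} (hf : ContDiff ℝ ∞ f) (v : E) : ContDiff ℝ ∞ (dbarDir v f) := by
  have h : ContDiff ℝ ∞ (fderiv ℝ f) := hf.fderiv_right (by simp)
  exact ((h.clm_apply contDiff_const).add (contDiff_const.mul (h.clm_apply contDiff_const))).div_const 2

lemma HasCompactSupport.dbarDir {f : E → ℂ} (hf : HasCompactSupport f) (v : E) :
    HasCompactSupport (dbarDir v f) :=
  (hf.fderiv (𝕜 := ℝ)).mono fun x hx h => hx (dbarDir_of_fderiv_eq_zero (by simpa using h))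

open scoped ContDiff in
lemma dbarDir_comm {f : E → ℂ} (hf : ContDiff ℝ ∞ f) (v w x : E) :
    dbarDir v (dbarDir w f) x = dbarDir w (dbarDir v f) x := by
  have h1 : Differentiable ℝ (fderiv ℝ f) :=
    (hf.fderiv_right (m := ∞) (by simp)).differentiable (by simp)
  have key : ∀ a b : E, fderiv ℝ (fun y => fderiv ℝ f y a) x b = fderiv ℝ (fderiv ℝ f) x b a := by
    intro a b
    rw [fderiv_clm_apply (h1 x) (by fun_prop)]
    simp
  have hd : ∀ w' b : E, fderiv ℝ (dbarDir w' f) x b =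
      (fderiv ℝ (fderiv ℝ f) x b w' + Complex.I * fderiv ℝ (fderiv ℝ f) x b (Complex.I • w')) / 2 := by
    intro w' b
    have hda : ∀ a, DifferentiableAt ℝ (fun y => fderiv ℝ f y a) x := fun a =>
      (h1 x).clm_apply (by fun_prop)
    have : dbarDir w' f = fun y => (2⁻¹ : ℂ) * (fderiv ℝ f y w' + Complex.I * fderiv ℝ f y (Complex.I • w')) := by
      ext y; simp only [dbarDir]; ring
    rw [this, fderiv_const_mul (by fun_prop), fderiv_fun_add (hda _) (by fun_prop), fderiv_const_mul (hda _)]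
    simp only [_root_.smul_apply, _root_.add_apply, key, smul_eq_mul]
    ring
  have hs : ∀ a b, fderiv ℝ (fderiv ℝ f) x a b = fderiv ℝ (fderiv ℝ f) x b a :=
    fun a b => (hf.contDiffAt.isSymmSndFDerivAt (by rw [minSmoothness_of_isRCLikeNormedField]; exact WithTop.coe_le_coe.2 le_top)) a b
  rw [dbarDir, dbarDir, hd, hd, hd, hd, hs v w, hs (Complex.I • v) w, hs v (Complex.I • w),
    hs (Complex.I • v) (Complex.I • w)]
  ring
end dbarDir

lemma integral_dbarDir_eq_zero {f : ℂ → ℂ} (hf : ContDiff ℝ 1 f) (hc : HasCompactSupport f) :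
    ∫ ζ, dbarDir 1 f ζ = 0 := by
  have h := integral_dbarDir_div_sub (f := fun ζ => f ζ * ζ) (by fun_prop) (hc.mul_right) 0
  simp only [mul_zero, sub_zero] at h
  rw [← h]
  apply integral_congr_ae
  filter_upwards [Measure.ae_ne volume (0 : ℂ)] with ζ hζ
  rw [dbarDir_mul (hf.differentiable (by simp) _) (by fun_prop),
    dbarDir_of_differentiableAt (f := fun y : ℂ => y) (by fun_prop)]
  field_simp
  ring

lemma dbarDir_slice_fst {u : ℂ × ℂ → ℂ} (hu : Differentiable ℝ u) (a b : ℂ) :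
    dbarDir 1 (fun x => u (x, b)) a = dbarDir ((1, 0) : ℂ × ℂ) u (a, b) := by
  have h : HasFDerivAt (fun x => u (x, b)) ((fderiv ℝ u (a, b)).comp (ContinuousLinearMap.inl ℝ ℂ ℂ)) a :=
    (hu (a, b)).hasFDerivAt.comp a (hasFDerivAt_prodMk_left a b)
  simp [dbarDir, h.fderiv]

lemma dbarDir_slice_snd {u : ℂ × ℂ → ℂ} (hu : Differentiable ℝ u) (a b : ℂ) :
    dbarDir 1 (fun x => u (a, x)) b = dbarDir ((0, 1) : ℂ × ℂ) u (a, b) := by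
  have h : HasFDerivAt (fun x => u (a, x)) ((fderiv ℝ u (a, b)).comp (ContinuousLinearMap.inr ℝ ℂ ℂ)) b :=
    (hu (a, b)).hasFDerivAt.comp b (hasFDerivAt_prodMk_right a b)
  simp [dbarDir, h.fderiv]

lemma HasCompactSupport.slice_fst {u : ℂ × ℂ → ℂ} (hu : HasCompactSupport u) (b : ℂ) :
    HasCompactSupport (fun x => u (x, b)) :=
  hu.comp_isClosedEmbedding
    (Isometry.isClosedEmbedding (Isometry.of_dist_eq fun x y => by simp [Prod.dist_eq]))

lemma HasCompactSupport.slice_snd {u : ℂ × ℂ → ℂ} (hu : HasCompactSupport u) (a : ℂ) :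
    HasCompactSupport (fun x => u (a, x)) :=
  hu.comp_isClosedEmbedding
    (Isometry.isClosedEmbedding (Isometry.of_dist_eq fun x y => by simp [Prod.dist_eq]))

lemma integrable_div_fst_sub {g : ℂ × ℂ → ℂ} (hg : Continuous g) (hc : HasCompactSupport g) (a : ℂ) :
    Integrable (fun ζ : ℂ × ℂ => g ζ / (ζ.1 - a)) := by
  obtain ⟨R, hR0, hR⟩ := hc.isCompact.isBounded.exists_pos_norm_le
  obtain ⟨C, hC⟩ := hg.bounded_above_of_compact_support hc
  have h1 : LocallyIntegrable (fun ζ : ℂ => (ζ - a)⁻¹) := by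
    have h0 : LocallyIntegrable (fun ζ : ℂ => ζ⁻¹) := by
      refine locallyIntegrable_of_norm_le_rpow (C := 1) (α := 1) (by simp) (by simp) ?_ ?_
      · filter_upwards with x
        rw [Real.rpow_neg_one, norm_inv, one_mul]
      · exact measurable_id.inv.aestronglyMeasurable
    rw [locallyIntegrable_iff] at h0 ⊢
    intro k hk
    have h1 := h0 _ (hk.image (f := fun ζ => ζ - a) (by fun_prop))
    have h2 := ((measurePreserving_sub_right volume a).integrableOn_image
      (MeasurableEquiv.subRight a).measurableEmbedding (f := fun ζ : ℂ => ζ⁻¹) (s := k)).1 h1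
    exact h2
  have h2 : Integrable (Set.indicator (Metric.closedBall (0:ℂ) R) (fun ζ : ℂ => (ζ - a)⁻¹)) :=
    (h1.integrableOn_isCompact (isCompact_closedBall _ _)).integrable_indicator measurableSet_closedBall
  have h3 : Integrable (Set.indicator (Metric.closedBall (0:ℂ) R) (fun _ : ℂ => (C : ℂ))) :=
    (integrableOn_const (isCompact_closedBall _ _).measure_lt_top.ne).integrable_indicator
      measurableSet_closedBall
  have h4 := h2.mul_prod h3
  refine h4.mono ?_ ?_
  · exact (hg.measurable.div (by fun_prop)).aestronglyMeasurable
  · filter_upwards with ζ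
    by_cases hζ : g ζ = 0
    · rw [hζ]; simp only [zero_div, norm_zero]; positivity
    have hb : ‖ζ‖ ≤ R := hR ζ (subset_tsupport _ hζ)
    have hb1 : ζ.1 ∈ Metric.closedBall (0:ℂ) R := by
      simpa using (norm_fst_le ζ).trans hb
    have hb2 : ζ.2 ∈ Metric.closedBall (0:ℂ) R := by
      simpa using (norm_snd_le ζ).trans hb
    have hC0 : 0 ≤ C := (norm_nonneg _).trans (hC ζ)
    rw [Set.indicator_of_mem hb1, Set.indicator_of_mem hb2, div_eq_mul_inv, mul_comm, norm_mul,
      norm_mul, Complex.norm_real, Real.norm_eq_abs, abs_of_nonneg hC0]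
    gcongr
    exact hC ζ

section
open scoped ContDiff

lemma mul_dbarDir_sub_mul_dbarDir {s₁ s₂ : ℂ × ℂ → ℂ} {ζ z : ℂ × ℂ} (v : ℂ × ℂ)
    (h₁ : DifferentiableAt ℝ s₁ ζ) (h₂ : DifferentiableAt ℝ s₂ ζ)
    (h : ∀ᶠ ξ in nhds ζ, s₁ ξ * (ξ.1 - z.1) + s₂ ξ * (ξ.2 - z.2) = 1) :
    (s₁ ζ * dbarDir v s₂ ζ - s₂ ζ * dbarDir v s₁ ζ) * (ζ.1 - z.1) = dbarDir v s₂ ζ := by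
  have hd : dbarDir v (fun ξ => s₁ ξ * (ξ.1 - z.1) + s₂ ξ * (ξ.2 - z.2)) ζ = 0 := by
    rw [dbarDir_congr (g := fun _ => (1 : ℂ)) h]
    exact dbarDir_of_fderiv_eq_zero (by simp)
  rw [dbarDir_add (by fun_prop) (by fun_prop), dbarDir_mul h₁ (by fun_prop),
    dbarDir_mul h₂ (by fun_prop), dbarDir_of_differentiableAt (f := fun ξ : ℂ × ℂ => ξ.1 - z.1) (by fun_prop),
    dbarDir_of_differentiableAt (f := fun ξ : ℂ × ℂ => ξ.2 - z.2) (by fun_prop)] at hd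
  linear_combination (dbarDir v s₂ ζ) * h.self_of_nhds - s₂ ζ * hd

/-- A Cauchy–Fantappiè formula for compactly supported functions on `ℂ²`. -/
theorem integral_cauchyFantappie {χ s₁ s₂ : ℂ × ℂ → ℂ} (hχ : ContDiff ℝ ∞ χ)
    (hs₁ : ContDiff ℝ ∞ s₁) (hs₂ : ContDiff ℝ ∞ s₂) (hc : HasCompactSupport χ) (z : ℂ × ℂ)
    (h : ∀ ζ, fderiv ℝ χ ζ ≠ 0 → s₁ ζ * (ζ.1 - z.1) + s₂ ζ * (ζ.2 - z.2) = 1) :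
    ∫ ζ, (dbarDir (1, 0) χ ζ * (s₁ ζ * dbarDir (0, 1) s₂ ζ - s₂ ζ * dbarDir (0, 1) s₁ ζ) -
      dbarDir (0, 1) χ ζ * (s₁ ζ * dbarDir (1, 0) s₂ ζ - s₂ ζ * dbarDir (1, 0) s₁ ζ)) =
    -Real.pi ^ 2 * χ z := by
  set u : ℂ × ℂ → ℂ := fun ζ => dbarDir (1, 0) χ ζ * s₂ ζ with hu
  set v : ℂ × ℂ → ℂ := fun ζ => dbarDir (0, 1) χ ζ * s₂ ζ with hv
  have hus : ContDiff ℝ ∞ u := (hχ.dbarDir _).mul hs₂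
  have hvs : ContDiff ℝ ∞ v := (hχ.dbarDir _).mul hs₂
  have huc : HasCompactSupport u := (hc.dbarDir _).mul_right
  have hvc : HasCompactSupport v := (hc.dbarDir _).mul_right
  have one_le : (1 : WithTop ℕ∞) ≤ ∞ := by exact_mod_cast le_top
  have hne : ∀ᵐ ζ : ℂ × ℂ, ζ.1 ≠ z.1 :=
    Measure.quasiMeasurePreserving_fst.ae (Measure.ae_ne volume z.1)
  have hd : ∀ {f : ℂ × ℂ → ℂ}, ContDiff ℝ ∞ f → Differentiable ℝ f := fun hf =>
    hf.differentiable (by simp)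
  have hae : ∀ᵐ ζ : ℂ × ℂ,
      (dbarDir (1, 0) χ ζ * (s₁ ζ * dbarDir (0, 1) s₂ ζ - s₂ ζ * dbarDir (0, 1) s₁ ζ) -
        dbarDir (0, 1) χ ζ * (s₁ ζ * dbarDir (1, 0) s₂ ζ - s₂ ζ * dbarDir (1, 0) s₁ ζ)) =
      dbarDir (0, 1) u ζ / (ζ.1 - z.1) - dbarDir (1, 0) v ζ / (ζ.1 - z.1) := by
    filter_upwards [hne] with ζ hζ
    have hζ' : ζ.1 - z.1 ≠ 0 := sub_ne_zero.2 hζ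
    rw [hu, hv, dbarDir_mul (hd (hχ.dbarDir _) ζ) (hd hs₂ ζ),
      dbarDir_mul (hd (hχ.dbarDir _) ζ) (hd hs₂ ζ), dbarDir_comm hχ (0, 1) (1, 0), ← sub_div,
      eq_div_iff hζ']
    by_cases h0 : fderiv ℝ χ ζ = 0
    · simp only [dbarDir_of_fderiv_eq_zero h0]
      ring
    · have hev : ∀ᶠ ξ in nhds ζ, s₁ ξ * (ξ.1 - z.1) + s₂ ξ * (ξ.2 - z.2) = 1 := by
        filter_upwards [(hχ.continuous_fderiv (by simp)).continuousAt.eventually_ne h0] with ξ hξ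
        exact h ξ hξ
      have e1 := mul_dbarDir_sub_mul_dbarDir (1, 0) (hd hs₁ ζ) (hd hs₂ ζ) hev
      have e2 := mul_dbarDir_sub_mul_dbarDir (0, 1) (hd hs₁ ζ) (hd hs₂ ζ) hev
      linear_combination dbarDir (1, 0) χ ζ * e2 - dbarDir (0, 1) χ ζ * e1
  have hiu := integrable_div_fst_sub (hus.dbarDir (0, 1)).continuous (huc.dbarDir (0, 1)) z.1
  have hiv := integrable_div_fst_sub (hvs.dbarDir (1, 0)).continuous (hvc.dbarDir (1, 0)) z.1
  rw [integral_congr_ae hae, integral_sub hiu hiv]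
  have h1 : ∫ ζ : ℂ × ℂ, dbarDir (0, 1) u ζ / (ζ.1 - z.1) = 0 := by
    rw [Measure.volume_eq_prod, integral_prod _ (by rwa [← Measure.volume_eq_prod])]
    have : ∀ x : ℂ, ∫ y : ℂ, dbarDir (0, 1) u (x, y) / (x - z.1) = 0 := by
      intro x
      simp_rw [← dbarDir_slice_snd (hd hus)]
      rw [integral_div, integral_dbarDir_eq_zero _ (huc.slice_snd x), zero_div]
      exact (hus.of_le one_le).comp (by fun_prop)
    simp [this]
  have h2 : ∫ ζ : ℂ × ℂ, dbarDir (1, 0) v ζ / (ζ.1 - z.1) = Real.pi ^ 2 * χ z := by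
    rw [Measure.volume_eq_prod, integral_prod_symm _ (by rwa [← Measure.volume_eq_prod])]
    have h3 : ∀ y : ℂ, ∫ x : ℂ, dbarDir (1, 0) v (x, y) / (x - z.1) = -Real.pi * v (z.1, y) := by
      intro y
      simp_rw [← dbarDir_slice_fst (hd hvs)]
      exact integral_dbarDir_div_sub (f := fun x => v (x, y))
        ((hvs.of_le one_le).comp (by fun_prop)) (hvc.slice_fst y) z.1
    simp_rw [h3]
    rw [integral_const_mul]
    have h4 : ∫ y : ℂ, v (z.1, y) = ∫ y : ℂ, dbarDir 1 (fun y => χ (z.1, y)) y / (y - z.2) := by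
      apply integral_congr_ae
      filter_upwards [Measure.ae_ne volume z.2] with y hy
      have hy' : y - z.2 ≠ 0 := sub_ne_zero.2 hy
      rw [dbarDir_slice_snd (hd hχ), eq_div_iff hy', hv]
      by_cases h0 : fderiv ℝ χ (z.1, y) = 0
      · simp only [dbarDir_of_fderiv_eq_zero h0]
        ring
      · have := h _ h0
        simp only [sub_self, mul_zero, zero_add] at this
        linear_combination dbarDir (0, 1) χ (z.1, y) * this
    rw [h4, integral_dbarDir_div_sub (f := fun y => χ (z.1, y))
      ((hχ.of_le one_le).comp (by fun_prop)) (hc.slice_snd z.1)]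
    ring
  rw [h1, h2]
  ring

end

section
open scoped ContDiff Manifold

/-- Hefer's decomposition, in a commutative normed algebra. -/
lemma exists_hefer {σ A : Type*} [Fintype σ] [NormedCommRing A] [NormedAlgebra ℂ A] (w : σ → A)
    (p : MvPolynomial σ ℂ) :
    ∃ a : σ → (σ → ℂ) → A, (∀ i, ContDiff ℝ ∞ (a i)) ∧ ∀ ζ,
      algebraMap ℂ A (MvPolynomial.eval ζ p) - MvPolynomial.aeval w p =
        ∑ i, a i ζ * (algebraMap ℂ A (ζ i) - w i) := by
  classical
  induction p using MvPolynomial.induction_on with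
  | C c => exact ⟨fun _ _ => 0, fun _ => contDiff_const, fun ζ => by simp⟩
  | add p q hp hq =>
    obtain ⟨a, ha, ha'⟩ := hp
    obtain ⟨b, hb, hb'⟩ := hq
    refine ⟨fun i ζ => a i ζ + b i ζ, fun i => (ha i).add (hb i), fun ζ => ?_⟩
    simp only [add_mul, Finset.sum_add_distrib, ← ha', ← hb', map_add]
    ring
  | mul_X p j hp =>
    obtain ⟨a, ha, ha'⟩ := hp
    refine ⟨fun i ζ => algebraMap ℂ A (ζ j) * a i ζ + if i = j then MvPolynomial.aeval w p else 0,
      fun i => ?_, fun ζ => ?_⟩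
    · refine ContDiff.add (ContDiff.mul ?_ (ha i)) contDiff_const
      have h1 : ContDiff ℝ ∞ (algebraMapCLM ℂ A) :=
        (algebraMapCLM ℂ A).contDiff.restrict_scalars ℝ
      exact h1.comp (by fun_prop)
    · simp only [add_mul, Finset.sum_add_distrib, mul_assoc, ← Finset.mul_sum, ← ha', map_mul,
        MvPolynomial.eval_X, MvPolynomial.aeval_X, ite_mul, zero_mul, Finset.sum_ite_eq',
        Finset.mem_univ, if_true]
      ring

lemma ContDiff.smul_of_tsupport_subset {E F : Type*} [NormedAddCommGroup E] [NormedSpace ℝ E]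
    [NormedAddCommGroup F] [NormedSpace ℝ F] {φ : E → ℝ} {b : E → F} {U : Set E} {n : WithTop ℕ∞}
    (hφ : ContDiff ℝ n φ) (hb : ∀ x ∈ U, ContDiffAt ℝ n b x) (h : tsupport φ ⊆ U) :
    ContDiff ℝ n fun x => φ x • b x := by
  refine contDiff_iff_contDiffAt.2 fun x => ?_
  by_cases hx : x ∈ tsupport φ
  · exact hφ.contDiffAt.smul (hb x (h hx))
  · refine (contDiffAt_const (c := (0 : F))).congr_of_eventuallyEq ?_
    filter_upwards [notMem_tsupport_iff_eventuallyEq.1 hx] with y hy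
    simp [hy]

section BanachAlgebra
variable {A : Type*} [NormedCommRing A] [NormedAlgebra ℂ A] [CompleteSpace A]

lemma exists_forall_algHom_eq_of_cauchyFantappie {χ : ℂ × ℂ → ℂ} (hχ : ContDiff ℝ ∞ χ)
    (hc : HasCompactSupport χ) (w : Fin 2 → A) {S₁ S₂ : ℂ × ℂ → A}
    (hS₁ : ContDiff ℝ ∞ S₁) (hS₂ : ContDiff ℝ ∞ S₂)
    (h : ∀ ζ, fderiv ℝ χ ζ ≠ 0 →
      S₁ ζ * (algebraMap ℂ A ζ.1 - w 0) + S₂ ζ * (algebraMap ℂ A ζ.2 - w 1) = 1) :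
    ∃ g : A, ∀ ev : A →ₐ[ℂ] ℂ, ev g = χ (ev (w 0), ev (w 1)) := by
  let D : ℂ × ℂ → (ℂ × ℂ → A) → ℂ × ℂ → A := fun v S ζ =>
    (2⁻¹ : ℂ) • (fderiv ℝ S ζ v + Complex.I • fderiv ℝ S ζ (Complex.I • v))
  have hDc : ∀ v {S}, ContDiff ℝ ∞ S → Continuous (D v S) := fun v S hS => by
    have := hS.continuous_fderiv (by simp)
    exact ((this.clm_apply continuous_const).add
      ((this.clm_apply continuous_const).const_smul _)).const_smul _
  have hDev : ∀ v {S} (ev : A →L[ℂ] ℂ), ContDiff ℝ ∞ S → ∀ ζ,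
      ev (D v S ζ) = dbarDir v (fun ξ => ev (S ξ)) ζ := fun v S ev hS ζ => by
    have h1 : HasFDerivAt (fun ξ => ev (S ξ)) ((ev.restrictScalars ℝ).comp (fderiv ℝ S ζ)) ζ :=
      (ev.restrictScalars ℝ).hasFDerivAt.comp ζ (hS.differentiable (by simp) ζ).hasFDerivAt
    simp only [D, dbarDir, h1.fderiv, map_smul, map_add, smul_eq_mul, ContinuousLinearMap.comp_apply,
      ContinuousLinearMap.coe_restrictScalars']
    ring
  let G : ℂ × ℂ → A := fun ζ =>
    dbarDir (1, 0) χ ζ • (S₁ ζ * D (0, 1) S₂ ζ - S₂ ζ * D (0, 1) S₁ ζ) -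
      dbarDir (0, 1) χ ζ • (S₁ ζ * D (1, 0) S₂ ζ - S₂ ζ * D (1, 0) S₁ ζ)
  have hG : Continuous G := by
    have a1 := (hχ.dbarDir (1, 0)).continuous
    have a2 := (hχ.dbarDir (0, 1)).continuous
    have a3 := hS₁.continuous
    have a4 := hS₂.continuous
    have a5 := hDc (1, 0) hS₁
    have a6 := hDc (0, 1) hS₁
    have a7 := hDc (1, 0) hS₂
    have a8 := hDc (0, 1) hS₂
    fun_prop
  have hGc : HasCompactSupport G := by
    apply HasCompactSupport.sub
    · exact (hc.dbarDir (1, 0)).smul_right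
    · exact (hc.dbarDir (0, 1)).smul_right
  have hGi : Integrable G := hG.integrable_of_hasCompactSupport hGc
  refine ⟨(-(Real.pi : ℂ) ^ 2)⁻¹ • ∫ ζ, G ζ, fun ev => ?_⟩
  have hev := ev.toContinuousLinearMap.integral_comp_comm hGi
  have hf := integral_cauchyFantappie (s₁ := fun ζ => ev (S₁ ζ)) (s₂ := fun ζ => ev (S₂ ζ)) hχ
    ((ev.toContinuousLinearMap.contDiff.restrict_scalars ℝ).comp hS₁)
    ((ev.toContinuousLinearMap.contDiff.restrict_scalars ℝ).comp hS₂) hc (ev (w 0), ev (w 1))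
    (fun ζ hζ => by simpa [AlgHomClass.commutes] using congrArg ev (h ζ hζ))
  have hp : (-(Real.pi : ℂ) ^ 2) ≠ 0 := neg_ne_zero.2 (pow_ne_zero _ (by exact_mod_cast Real.pi_ne_zero))
  rw [map_smul, smul_eq_mul, inv_mul_eq_iff_eq_mul₀ hp, ← hf]
  refine Eq.trans hev.symm (integral_congr_ae (Filter.Eventually.of_forall fun ζ => ?_))
  have e1 := fun v => hDev v ev.toContinuousLinearMap hS₁ ζ
  have e2 := fun v => hDev v ev.toContinuousLinearMap hS₂ ζ
  simp only [AlgHom.coe_toContinuousLinearMap] at e1 e2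
  simp only [G, AlgHom.coe_toContinuousLinearMap, map_sub, map_smul, map_mul, e1, e2, smul_eq_mul]

/-- A smooth compactly supported function on `ℂ²` which is locally constant at every point that is
not in the polynomial hull of `w` acts on the pair `w` of elements of a Banach algebra. -/
lemma exists_forall_algHom_eq [NormOneClass A] {χ : ℂ × ℂ → ℂ} (hχ : ContDiff ℝ ∞ χ)
    (hc : HasCompactSupport χ) (w : Fin 2 → A)
    (h : ∀ ζ ∈ tsupport (fderiv ℝ χ), ∃ p : MvPolynomial (Fin 2) ℂ,
      ‖MvPolynomial.aeval w p‖ < ‖MvPolynomial.eval ![ζ.1, ζ.2] p‖) :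
    ∃ g : A, ∀ ev : A →ₐ[ℂ] ℂ, ev g = χ (ev (w 0), ev (w 1)) := by
  classical
  let U : MvPolynomial (Fin 2) ℂ → Set (ℂ × ℂ) := fun p =>
    {ζ | ‖MvPolynomial.aeval w p‖ < ‖MvPolynomial.eval ![ζ.1, ζ.2] p‖}
  have hec : ∀ p : MvPolynomial (Fin 2) ℂ,
      Continuous fun ζ : ℂ × ℂ => MvPolynomial.eval ![ζ.1, ζ.2] p := fun p =>
    (MvPolynomial.continuous_eval p).comp (by fun_prop)
  have hU : ∀ p, IsOpen (U p) := fun p => isOpen_lt continuous_const (hec p).norm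
  obtain ⟨t, ht⟩ := (hc.fderiv (𝕜 := ℝ)).isCompact.elim_finite_subcover U hU
    (fun ζ hζ => mem_iUnion.2 (h ζ hζ))
  obtain ⟨φ, hφ⟩ := SmoothPartitionOfUnity.exists_isSubordinate 𝓘(ℝ, ℂ × ℂ)
    (isClosed_tsupport (fderiv ℝ χ)) (fun p : t => U p) (fun p => hU p)
    (by intro ζ hζ; have := ht hζ; simp only [mem_iUnion] at this ⊢; obtain ⟨p, hp, h⟩ := this
        exact ⟨⟨p, hp⟩, h⟩)
  choose a ha ha' using fun p : MvPolynomial (Fin 2) ℂ => exists_hefer w p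
  have hcoord : ContDiff ℝ ∞ fun ζ : ℂ × ℂ => (![ζ.1, ζ.2] : Fin 2 → ℂ) := by
    refine contDiff_pi.2 fun i => ?_
    fin_cases i
    · exact contDiff_fst
    · exact contDiff_snd
  have hevd : ∀ p : MvPolynomial (Fin 2) ℂ, ContDiff ℝ ∞ fun ζ : ℂ × ℂ =>
      algebraMap ℂ A (MvPolynomial.eval ![ζ.1, ζ.2] p) - MvPolynomial.aeval w p := by
    intro p
    simp only [fun ζ : ℂ × ℂ => ha' p ![ζ.1, ζ.2]]
    refine ContDiff.sum fun i _ => ((ha p i).comp hcoord).mul (ContDiff.sub ?_ contDiff_const)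
    exact ((algebraMapCLM ℂ A).contDiff.restrict_scalars ℝ).comp (contDiff_pi.1 hcoord i)
  let b : MvPolynomial (Fin 2) ℂ → Fin 2 → ℂ × ℂ → A := fun p i ζ => a p i ![ζ.1, ζ.2] *
    Ring.inverse (algebraMap ℂ A (MvPolynomial.eval ![ζ.1, ζ.2] p) - MvPolynomial.aeval w p)
  have hunit : ∀ p, ∀ ζ ∈ U p,
      IsUnit (algebraMap ℂ A (MvPolynomial.eval ![ζ.1, ζ.2] p) - MvPolynomial.aeval w p) :=
    fun p ζ hζ => spectrum.mem_resolventSet_of_norm_lt hζ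
  have hb : ∀ p i, ∀ ζ ∈ U p, ContDiffAt ℝ ∞ (b p i) ζ := by
    intro p i ζ hζ
    refine ContDiffAt.mul ((ha p i).comp hcoord).contDiffAt ?_
    obtain ⟨u, hu⟩ := hunit p ζ hζ
    have := contDiffAt_ringInverse ℝ (n := ∞) u
    rw [hu] at this
    exact this.comp ζ (hevd p).contDiffAt
  have hb1 : ∀ p, ∀ ζ ∈ U p,
      b p 0 ζ * (algebraMap ℂ A ζ.1 - w 0) + b p 1 ζ * (algebraMap ℂ A ζ.2 - w 1) = 1 := by
    intro p ζ hζ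
    have e := Ring.inverse_mul_cancel _ (hunit p ζ hζ)
    have e2 := ha' p ![ζ.1, ζ.2]
    simp only [Fin.sum_univ_two, Matrix.cons_val_zero, Matrix.cons_val_one] at e2
    simp only [b]
    rw [← e]
    nth_rewrite 4 [e2]
    ring
  have hS : ∀ i, ContDiff ℝ ∞ fun ζ => ∑ p : t, φ p ζ • b p i ζ := fun i =>
    ContDiff.sum fun p _ =>
      (φ p).contMDiff.contDiff.smul_of_tsupport_subset (hb p i) (hφ p)
  refine exists_forall_algHom_eq_of_cauchyFantappie hχ hc w (hS 0) (hS 1) fun ζ hζ => ?_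
  have hsum : ∑ p : t, φ p ζ = 1 := by
    rw [← finsum_eq_sum_of_fintype]
    exact φ.sum_eq_one (subset_tsupport _ hζ)
  rw [Finset.sum_mul, Finset.sum_mul, ← Finset.sum_add_distrib]
  have : ∀ p : t, φ p ζ • b p 0 ζ * (algebraMap ℂ A ζ.1 - w 0) +
      φ p ζ • b p 1 ζ * (algebraMap ℂ A ζ.2 - w 1) = φ p ζ • (1 : A) := by
    intro p
    by_cases hp : φ p ζ = 0
    · simp [hp]
    · rw [smul_mul_assoc, smul_mul_assoc, ← smul_add, hb1 p ζ (hφ p (subset_tsupport _ hp))]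
  rw [Finset.sum_congr rfl fun p _ => this p, ← Finset.sum_smul, hsum, one_smul]
end BanachAlgebra
end

section
open scoped ContDiff Manifold

lemma exists_contDiff_eventuallyEq_const {E : Type*} [NormedAddCommGroup E] [NormedSpace ℝ E]
    [FiniteDimensional ℝ E] {L : Set E} (hL : IsCompact L) {θ : E → ℝ} (hθ : ContinuousOn θ L)
    (hfin : (θ '' L).Finite) :
    ∃ χ : E → ℂ, ContDiff ℝ ∞ χ ∧ HasCompactSupport χ ∧
      ∀ z ∈ L, χ =ᶠ[nhds z] fun _ => (θ z : ℂ) := by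
  classical
  have : ProperSpace E := FiniteDimensional.proper ℝ E
  obtain ⟨R, hR⟩ := hL.isBounded.subset_ball (0 : E)
  have hcl : ∀ t, IsClosed (L ∩ θ ⁻¹' {t}) := fun t =>
    hθ.preimage_isClosed_of_isClosed hL.isClosed isClosed_singleton
  have hf : ∀ t : ℝ, ∃ f : E → ℝ, ContDiff ℝ ∞ f ∧ HasCompactSupport f ∧
      ∀ z ∈ L, ∀ᶠ x in nhds z, f x = if θ z = t then 1 else 0 := by
    intro t
    obtain ⟨f, h0, h1, -⟩ := exists_contMDiffMap_zero_one_nhds_of_isClosed (n := ⊤) 𝓘(ℝ, E)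
      (s := (⋃ s ∈ (θ '' L) \ {t}, L ∩ θ ⁻¹' {s}) ∪ (Metric.ball (0 : E) R)ᶜ) (t := L ∩ θ ⁻¹' {t})
      (((hfin.subset sdiff_subset).isClosed_biUnion fun s _ => hcl s).union
        Metric.isOpen_ball.isClosed_compl) (hcl t) (by
        refine disjoint_left.2 fun x hx hx' => ?_
        rcases hx with hx | hx
        · simp only [mem_iUnion] at hx
          obtain ⟨s, hs, hx⟩ := hx
          exact hs.2 (hx.2.symm.trans hx'.2)
        · exact hx (hR hx'.1))
    refine ⟨f, f.contMDiff.contDiff, ?_, fun z hz => ?_⟩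
    · refine HasCompactSupport.intro (isCompact_closedBall (0 : E) R) fun x hx => ?_
      exact h0.self_of_nhdsSet x (Or.inr fun h => hx (Metric.ball_subset_closedBall h))
    · split_ifs with h
      · exact h1.filter_mono (nhds_le_nhdsSet (show z ∈ L ∩ θ ⁻¹' {t} from ⟨hz, h⟩))
      · refine h0.filter_mono (nhds_le_nhdsSet (mem_union_left _ ?_))
        simp only [mem_iUnion]
        exact ⟨θ z, ⟨mem_image_of_mem _ hz, h⟩, hz, rfl⟩
  choose f hfs hfc hfe using hf
  refine ⟨fun x => ∑ t ∈ hfin.toFinset, (t : ℂ) * (f t x : ℂ), ?_, ?_, fun z hz => ?_⟩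
  · exact ContDiff.sum fun t _ => contDiff_const.mul (Complex.ofRealCLM.contDiff.comp (hfs t))
  · have : ∀ s : Finset ℝ, HasCompactSupport fun x => ∑ t ∈ s, (t : ℂ) * (f t x : ℂ) := by
      intro s
      induction s using Finset.induction_on with
      | empty => exact HasCompactSupport.zero
      | insert a s ha ih =>
        simp only [Finset.sum_insert ha]
        refine HasCompactSupport.add ?_ ih
        exact ((hfc a).comp_left (g := fun r : ℝ => (r : ℂ)) (by simp)).mul_left
    exact this _
  · have : ∀ᶠ x in nhds z, ∀ t ∈ hfin.toFinset, f t x = if θ z = t then 1 else 0 :=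
      (Filter.eventually_all_finset _).2 fun t _ => hfe t z hz
    filter_upwards [this] with x hx
    rw [Finset.sum_congr rfl fun t ht => by rw [hx t ht]]
    simp only [apply_ite (fun r : ℝ => (r : ℂ)), Complex.ofReal_one, Complex.ofReal_zero,
      mul_ite, mul_one, mul_zero, Finset.sum_ite_eq]
    rw [if_pos (hfin.mem_toFinset.2 (mem_image_of_mem _ hz))]
end

lemma exists_mem_topologicalClosure_forall_algHom_eq {B : Type*} [NormedCommRing B]
    [NormedAlgebra ℂ B] [CompleteSpace B] [NormOneClass B] {χ : ℂ × ℂ → ℂ}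
    (hχ : ContDiff ℝ (⊤ : ℕ∞) χ) (hc : HasCompactSupport χ) (w : Fin 2 → B)
    (h : ∀ ζ ∈ tsupport (fderiv ℝ χ), ∃ p : MvPolynomial (Fin 2) ℂ,
      ‖MvPolynomial.aeval w p‖ < ‖MvPolynomial.eval ![ζ.1, ζ.2] p‖) :
    ∃ g ∈ (MvPolynomial.aeval (R := ℂ) w).range.topologicalClosure,
      ∀ ev : B →ₐ[ℂ] ℂ, ev g = χ (ev (w 0), ev (w 1)) := by
  let A := (MvPolynomial.aeval (R := ℂ) w).range.topologicalClosure
  have : CompleteSpace A :=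
    (Subalgebra.isClosed_topologicalClosure (MvPolynomial.aeval (R := ℂ) w).range).completeSpace_coe
  have : NormOneClass A := ⟨(norm_one : ‖(1 : B)‖ = 1)⟩
  let v : Fin 2 → A := fun i =>
    ⟨w i, Subalgebra.le_topologicalClosure _ ⟨MvPolynomial.X i, MvPolynomial.aeval_X _ _⟩⟩
  have hv : ∀ p, ((MvPolynomial.aeval v p : A) : B) = MvPolynomial.aeval w p := fun p => by
    rw [← Subalgebra.coe_val, MvPolynomial.comp_aeval_apply]
    rfl
  obtain ⟨g, hg⟩ := exists_forall_algHom_eq hχ hc v fun ζ hζ => by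
    obtain ⟨p, hp⟩ := h ζ hζ
    refine ⟨p, ?_⟩
    rwa [← hv] at hp
  exact ⟨g, g.2, fun ev => hg (ev.comp A.val)⟩

/-- Restriction of polynomials to a set, as continuous functions. -/
def polyRestrict (L : Set (Fin 2 → ℂ)) : MvPolynomial (Fin 2) ℂ →ₐ[ℂ] C(L, ℂ) :=
  MvPolynomial.aeval fun i => ⟨fun z => z.1 i, (continuous_apply i).comp continuous_subtype_val⟩

lemma polyRestrict_apply (L : Set (Fin 2 → ℂ)) (p : MvPolynomial (Fin 2) ℂ) (z : L) :
    polyRestrict L p z = MvPolynomial.eval z.1 p := by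
  induction p using MvPolynomial.induction_on with
  | C c => simp [polyRestrict]
  | add p q hp hq => simp [hp, hq]
  | mul_X p j hp => simp [hp]; simp [polyRestrict]

lemma aeval_polyRestrict_X (L : Set (Fin 2 → ℂ)) (p : MvPolynomial (Fin 2) ℂ) :
    MvPolynomial.aeval (fun i => polyRestrict L (MvPolynomial.X i)) p = polyRestrict L p := by
  rw [← MvPolynomial.comp_aeval_apply, MvPolynomial.aeval_X_left_apply]

lemma bddAbove_norm_eval_image {L : Set (Fin 2 → ℂ)} (hL : IsCompact L)
    (p : MvPolynomial (Fin 2) ℂ) : BddAbove ((fun w => ‖MvPolynomial.eval w p‖) '' L) :=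
  (hL.image (MvPolynomial.continuous_eval p).norm).bddAbove

lemma exists_mvPolynomial_approx_of_fderiv_eq_zero {L : Set (Fin 2 → ℂ)} (hL : IsCompact L)
    (hpc : polyHull 2 L ⊆ L) {χ : ℂ × ℂ → ℂ} (hχ : ContDiff ℝ (⊤ : ℕ∞) χ)
    (hc : HasCompactSupport χ)
    (hloc : ∀ z ∈ L, fderiv ℝ χ =ᶠ[nhds (z 0, z 1)] 0) {ε : ℝ} (hε : 0 < ε) :
    ∃ p : MvPolynomial (Fin 2) ℂ, ∀ z ∈ L, ‖χ (z 0, z 1) - MvPolynomial.eval z p‖ < ε := by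
  rcases L.eq_empty_or_nonempty with rfl | hne
  · exact ⟨0, by simp⟩
  have : Nonempty L := hne.to_subtype
  have : CompactSpace L := isCompact_iff_compactSpace.1 hL
  obtain ⟨g, hgA, hg⟩ := exists_mem_topologicalClosure_forall_algHom_eq hχ hc
    (fun i => polyRestrict L (MvPolynomial.X i)) (by
    intro ζ hζ
    have hζL : (![ζ.1, ζ.2] : Fin 2 → ℂ) ∉ polyHull 2 L := by
      intro h
      exact notMem_tsupport_iff_eventuallyEq.2 (hloc _ (hpc h)) hζ
    simp only [polyHull, Set.mem_ofPred_eq, not_forall, not_le] at hζL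
    obtain ⟨p, hp⟩ := hζL
    refine ⟨p, lt_of_le_of_lt ?_ hp⟩
    rw [aeval_polyRestrict_X, ContinuousMap.norm_le_of_nonempty]
    intro z
    rw [polyRestrict_apply]
    exact le_csSup (bddAbove_norm_eval_image hL p) (mem_image_of_mem _ z.2))
  obtain ⟨q, ⟨p, rfl⟩, hq⟩ := Metric.mem_closure_iff.1 hgA ε hε
  refine ⟨p, fun z hz => ?_⟩
  have h1 := hg (ContinuousMap.evalAlgHom ℂ ℂ (⟨z, hz⟩ : L))
  have h2 : ∀ f : C(L, ℂ), ContinuousMap.evalAlgHom ℂ ℂ (⟨z, hz⟩ : L) f = f ⟨z, hz⟩ := fun _ => rfl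
  simp only [h2, polyRestrict_apply, MvPolynomial.eval_X] at h1
  rw [← h1, ← dist_eq_norm, ← polyRestrict_apply L p ⟨z, hz⟩, ← aeval_polyRestrict_X]
  exact (ContinuousMap.dist_apply_le_dist _).trans_lt hq

lemma exists_mvPolynomial_approx_of_finite_image {L : Set (Fin 2 → ℂ)} (hL : IsCompact L)
    (hpc : polyHull 2 L ⊆ L) {θ : (Fin 2 → ℂ) → ℝ} (hθ : ContinuousOn θ L)
    (hfin : (θ '' L).Finite) {ε : ℝ} (hε : 0 < ε) :
    ∃ p : MvPolynomial (Fin 2) ℂ, ∀ z ∈ L, ‖(θ z : ℂ) - MvPolynomial.eval z p‖ < ε := by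
  have hz : ∀ z : Fin 2 → ℂ, (![z 0, z 1] : Fin 2 → ℂ) = z := fun z => by
    ext i; fin_cases i <;> rfl
  have hcoord : Continuous fun ζ : ℂ × ℂ => (![ζ.1, ζ.2] : Fin 2 → ℂ) := by fun_prop
  obtain ⟨χ, hχ, hc, he⟩ := exists_contDiff_eventuallyEq_const
    (hL.image (f := fun z => (z 0, z 1)) (by fun_prop))
    (θ := fun ζ : ℂ × ℂ => θ ![ζ.1, ζ.2])
    (hθ.comp hcoord.continuousOn (by rintro _ ⟨z, hzL, rfl⟩; simpa only [hz] using hzL))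
    (by
      rw [image_image]
      simpa only [hz] using hfin)
  have he' : ∀ z ∈ L, χ =ᶠ[nhds (z 0, z 1)] fun _ => (θ z : ℂ) := fun z hzL => by
    simpa only [hz] using he _ (mem_image_of_mem _ hzL)
  obtain ⟨p, hp⟩ := exists_mvPolynomial_approx_of_fderiv_eq_zero hL hpc hχ hc
    (fun z hzL => by
      filter_upwards [(he' z hzL).fderiv (𝕜 := ℝ)] with x hx
      rw [hx]; simp) hε
  exact ⟨p, fun z hzL => by simpa only [(he' z hzL).self_of_nhds] using hp z hzL⟩

section Representation
open scoped InnerProductSpace ComplexConjugate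

variable {X : Type*} [TopologicalSpace X]
  {E : Type*} [NormedAddCommGroup E] [InnerProductSpace ℂ E] [CompleteSpace E]

lemma inner_map_apply_left (π : C(X, ℂ) →⋆ₐ[ℂ] (E →L[ℂ] E)) (f : C(X, ℂ)) (x y : E) :
    ⟪π f x, y⟫_ℂ = ⟪x, π (star f) y⟫_ℂ := by
  rw [map_star, ContinuousLinearMap.star_eq_adjoint, ContinuousLinearMap.adjoint_inner_right]

lemma inner_map_apply_right (π : C(X, ℂ) →⋆ₐ[ℂ] (E →L[ℂ] E)) (f : C(X, ℂ)) (x y : E) :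
    ⟪x, π f y⟫_ℂ = ⟪π (star f) x, y⟫_ℂ := by
  rw [inner_map_apply_left, star_star]

lemma map_mul_apply (π : C(X, ℂ) →⋆ₐ[ℂ] (E →L[ℂ] E)) (f g : C(X, ℂ)) (x : E) :
    π (f * g) x = π f (π g x) := by
  rw [map_mul]; rfl

lemma map_const_apply (π : C(X, ℂ) →⋆ₐ[ℂ] (E →L[ℂ] E)) (c : ℂ) (x : E) :
    π (algebraMap ℂ _ c) x = c • x := by
  rw [AlgHomClass.commutes, Algebra.algebraMap_eq_smul_one]; rfl

lemma norm_map_apply_le_of_norm_le (π : C(X, ℂ) →⋆ₐ[ℂ] (E →L[ℂ] E)) {f g : C(X, ℂ)}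
    (h : ∀ t, ‖f t‖ ≤ ‖g t‖) (x : E) : ‖π f x‖ ≤ ‖π g x‖ := by
  let s : C(X, ℂ) := ⟨fun t => (Real.sqrt (‖g t‖ ^ 2 - ‖f t‖ ^ 2) : ℂ), by fun_prop⟩
  have hs : star f * f + star s * s = star g * g := by
    ext t
    have h0 : 0 ≤ ‖g t‖ ^ 2 - ‖f t‖ ^ 2 := by
      have := pow_le_pow_left₀ (norm_nonneg _) (h t) 2
      linarith
    simp only [s, ContinuousMap.add_apply, ContinuousMap.mul_apply, ContinuousMap.star_apply,
      ContinuousMap.coe_mk, RCLike.star_def, Complex.conj_mul', Complex.norm_real, Real.norm_eq_abs]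
    rw [abs_of_nonneg (Real.sqrt_nonneg _)]
    norm_cast
    rw [Real.sq_sqrt h0]
    ring
  have key : ∀ k : C(X, ℂ), (⟪x, π (star k * k) x⟫_ℂ).re = ‖π k x‖ ^ 2 := fun k => by
    rw [map_mul_apply, ← inner_map_apply_left]
    exact inner_self_eq_norm_sq (𝕜 := ℂ) _
  have := key g
  rw [← hs, map_add, _root_.add_apply, inner_add_right, Complex.add_re, key, key] at this
  exact (sq_le_sq₀ (norm_nonneg _) (norm_nonneg _)).1 (by nlinarith [sq_nonneg ‖π s x‖])

lemma norm_map_apply_eq_of_norm_eq (π : C(X, ℂ) →⋆ₐ[ℂ] (E →L[ℂ] E)) {f g : C(X, ℂ)}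
    (h : ∀ t, ‖f t‖ = ‖g t‖) (x : E) : ‖π f x‖ = ‖π g x‖ :=
  (norm_map_apply_le_of_norm_le π (fun t => (h t).le) x).antisymm
    (norm_map_apply_le_of_norm_le π (fun t => (h t).ge) x)

lemma norm_map_apply_le_add (π : C(X, ℂ) →⋆ₐ[ℂ] (E →L[ℂ] E)) {f g : C(X, ℂ)} {ε C : ℝ}
    (hε : 0 ≤ ε) (hC : 0 ≤ C) (h : ∀ t, ‖f t‖ ≤ ε + C * ‖g t‖) (x : E) :
    ‖π f x‖ ≤ ε * ‖x‖ + C * ‖π g x‖ := by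
  let k : C(X, ℂ) := ⟨fun t => (‖g t‖ : ℂ), by fun_prop⟩
  have hk : ‖π k x‖ = ‖π g x‖ := norm_map_apply_eq_of_norm_eq π (fun t => by simp [k]) x
  calc ‖π f x‖ ≤ ‖π (algebraMap ℂ _ (ε : ℂ) + (C : ℂ) • k) x‖ := by
        refine norm_map_apply_le_of_norm_le π (fun t => (h t).trans (le_of_eq ?_)) x
        simp only [k, ContinuousMap.add_apply, ContinuousMap.smul_apply, ContinuousMap.coe_mk,
          algebraMap_apply, smul_eq_mul, mul_one]
        norm_cast
        rw [Real.norm_of_nonneg (by positivity)]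
    _ = ‖(ε : ℂ) • x + (C : ℂ) • π k x‖ := by
        rw [map_add, _root_.add_apply, map_const_apply, map_smul, _root_.smul_apply]
    _ ≤ ‖(ε : ℂ) • x‖ + ‖(C : ℂ) • π k x‖ := norm_add_le _ _
    _ = ε * ‖x‖ + C * ‖π g x‖ := by
        rw [norm_smul, norm_smul, hk, Complex.norm_real, Complex.norm_real, Real.norm_of_nonneg hε,
          Real.norm_of_nonneg hC]

lemma norm_map_apply_le (π : C(X, ℂ) →⋆ₐ[ℂ] (E →L[ℂ] E)) {f : C(X, ℂ)} {C : ℝ} (hC : 0 ≤ C)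
    (h : ∀ t, ‖f t‖ ≤ C) (x : E) : ‖π f x‖ ≤ C * ‖x‖ := by
  simpa using norm_map_apply_le_add π (g := 0) hC le_rfl (fun t => by simpa using h t) x

/-- The continuous functions acting on a submodule. -/
def invariantSubalgebra (π : C(X, ℂ) →⋆ₐ[ℂ] (E →L[ℂ] E)) (H : Submodule ℂ E) :
    Subalgebra ℂ C(X, ℂ) where
  carrier := {f | ∀ x ∈ H, π f x ∈ H}
  mul_mem' {f g} hf hg x hx := by rw [map_mul_apply]; exact hf _ (hg x hx)
  add_mem' {f g} hf hg x hx := by rw [map_add]; exact H.add_mem (hf x hx) (hg x hx)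
  algebraMap_mem' c x hx := by rw [map_const_apply]; exact H.smul_mem c hx

lemma mem_invariantSubalgebra {π : C(X, ℂ) →⋆ₐ[ℂ] (E →L[ℂ] E)} {H : Submodule ℂ E} {f : C(X, ℂ)} :
    f ∈ invariantSubalgebra π H ↔ ∀ x ∈ H, π f x ∈ H := Iff.rfl

/-- The orthogonal complement in `H` of the range of `π u - l`. -/
def defectSpace (π : C(X, ℂ) →⋆ₐ[ℂ] (E →L[ℂ] E)) (H : Submodule ℂ E) (u : C(X, ℂ)) (l : ℂ) :
    Submodule ℂ E :=
  H ⊓ (H.map (π (u - algebraMap ℂ _ l)).toLinearMap)ᗮ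

lemma mem_defectSpace {π : C(X, ℂ) →⋆ₐ[ℂ] (E →L[ℂ] E)} {H : Submodule ℂ E} {u : C(X, ℂ)} {l : ℂ}
    {x : E} : x ∈ defectSpace π H u l ↔
      x ∈ H ∧ ∀ y ∈ H, ⟪π (u - algebraMap ℂ _ l) y, x⟫_ℂ = 0 := by
  simp only [defectSpace, Submodule.mem_inf, Submodule.mem_orthogonal, Submodule.mem_map,
    forall_exists_index, and_imp, forall_apply_eq_imp_iff₂, ContinuousLinearMap.coe_coe]

variable [CompactSpace X]

lemma isClosed_invariantSubalgebra (π : C(X, ℂ) →⋆ₐ[ℂ] (E →L[ℂ] E)) {H : Submodule ℂ E}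
    (hH : IsClosed (H : Set E)) : IsClosed (invariantSubalgebra π H : Set C(X, ℂ)) := by
  have : (invariantSubalgebra π H : Set C(X, ℂ)) = ⋂ x ∈ H, (fun f => π f x) ⁻¹' H := by
    ext f; simp [mem_invariantSubalgebra]
  rw [this]
  refine isClosed_biInter fun x _ => hH.preimage ?_
  let l : C(X, ℂ) →ₗ[ℂ] E :=
    { toFun := fun f => π f x
      map_add' := fun f g => by rw [map_add]; rfl
      map_smul' := fun c f => by rw [map_smul]; rfl }
  refine AddMonoidHomClass.continuous_of_bound l ‖x‖ fun f => ?_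
  rw [mul_comm]
  exact norm_map_apply_le π (norm_nonneg f) (fun t => f.norm_coe_le_norm t) x

lemma exists_mem_defectSpace_near {π : C(X, ℂ) →⋆ₐ[ℂ] (E →L[ℂ] E)} {H : Submodule ℂ E}
    (hH : IsClosed (H : Set E)) {u : C(X, ℂ)} (hu : ∀ t, ‖u t‖ = 1)
    (huH : u ∈ invariantSubalgebra π H) {a b : ℂ} (ha : ‖a‖ < 1) (hb : ‖b‖ < 1) {x : E}
    (hx : x ∈ defectSpace π H u a) :
    ∃ y ∈ defectSpace π H u b, ‖y - x‖ ≤ ‖a - b‖ / (1 - ‖b‖) * ‖x‖ ∧ (x ≠ 0 → y ≠ 0) := by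
  have hinv : ∀ c : ℂ, ‖c‖ < 1 → ∃ G ∈ invariantSubalgebra π H, G * (1 - conj c • u) = 1 := by
    intro c hc
    have hn : ‖conj c • u‖ < 1 := by
      rw [norm_smul, RCLike.norm_conj]
      refine lt_of_le_of_lt (mul_le_of_le_one_right (norm_nonneg _) ?_) hc
      exact (ContinuousMap.norm_le _ zero_le_one).2 fun t => (hu t).le
    refine ⟨∑' n : ℕ, (conj c • u) ^ n, ?_, geom_series_mul_neg _ hn⟩
    exact (isClosed_invariantSubalgebra π hH).mem_of_tendsto
      (summable_geometric_of_norm_lt_one hn).hasSum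
      (Filter.Eventually.of_forall fun s => Subalgebra.sum_mem _ fun n _ =>
        Subalgebra.pow_mem _ (Subalgebra.smul_mem _ huH _) _)
  obtain ⟨G, hG, hG1⟩ := hinv b hb
  obtain ⟨G', -, hG1'⟩ := hinv a ha
  have hGt : ∀ t, G t * (1 - conj b * u t) = 1 := fun t => by
    simpa using DFunLike.congr_fun hG1 t
  rw [mem_defectSpace] at hx
  have hmem : (1 - conj a • u) * G ∈ invariantSubalgebra π H :=
    Subalgebra.mul_mem _ (Subalgebra.sub_mem _ (Subalgebra.one_mem _)
      (Subalgebra.smul_mem _ huH _)) hG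
  refine ⟨π ((1 - conj a • u) * G) x, mem_defectSpace.2 ⟨hmem x hx.1, fun y hy => ?_⟩, ?_, ?_⟩
  · rw [inner_map_apply_right, ← map_mul_apply]
    have : star ((1 - conj a • u) * G) * (u - algebraMap ℂ _ b) = u - algebraMap ℂ _ a := by
      ext t
      have h1 : conj (G t) * (1 - b * conj (u t)) = 1 := by
        simpa using congrArg conj (hGt t)
      have h2 : u t * conj (u t) = 1 := by
        rw [Complex.mul_conj']; simp [hu]
      simp only [ContinuousMap.mul_apply, ContinuousMap.star_apply, ContinuousMap.sub_apply,
        ContinuousMap.one_apply, ContinuousMap.smul_apply, RCLike.star_def, map_mul, map_sub,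
        map_one, smul_eq_mul, algebraMap_apply, Complex.conj_conj, mul_one]
      linear_combination (u t * (1 - a * conj (u t))) * h1 + (b * conj (G t) * (1 - a * conj (u t)) - a) * h2
    rw [this]
    exact hx.2 y hy
  · have e : π ((1 - conj a • u) * G) x - x = π ((1 - conj a • u) * G - 1) x := by
      rw [map_sub, map_one]; rfl
    rw [e]
    have hb' : 0 < 1 - ‖b‖ := by linarith
    refine norm_map_apply_le π (by positivity) (fun t => ?_) x
    have h1 : ((1 - conj a • u) * G - 1) t = G t * (conj (b - a) * u t) := by
      simp only [ContinuousMap.mul_apply, ContinuousMap.sub_apply,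
        ContinuousMap.one_apply, ContinuousMap.smul_apply, smul_eq_mul, map_sub]
      linear_combination hGt t
    have h2 : ‖G t‖ * (1 - ‖b‖) ≤ 1 := by
      have : 1 - ‖b‖ ≤ ‖1 - conj b * u t‖ := by
        have := norm_sub_norm_le (1 : ℂ) (conj b * u t)
        simpa [hu] using this
      calc ‖G t‖ * (1 - ‖b‖) ≤ ‖G t‖ * ‖1 - conj b * u t‖ := by gcongr
        _ = 1 := by rw [← norm_mul, hGt, norm_one]
    rw [h1, norm_mul, norm_mul, RCLike.norm_conj, hu, mul_one, norm_sub_rev b a, le_div_iff₀ hb']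
    nlinarith [norm_nonneg (a - b)]
  · intro h0 h
    apply h0
    have : (G' * (1 - conj b • u)) * ((1 - conj a • u) * G) = 1 := by
      linear_combination (G * (1 - conj b • u)) * hG1' + hG1
    rw [← one_smul ℂ x, ← map_const_apply π, map_one, ← this, map_mul_apply, h, map_zero]
end Representation

section Rayleigh
open scoped InnerProductSpace ComplexConjugate

variable {E : Type*} [NormedAddCommGroup E] [InnerProductSpace ℂ E]

/-- The supremum of the quadratic form of `T` over the unit sphere of `W`. -/
def topRayleigh (T : E →L[ℂ] E) (W : Submodule ℂ E) : ℝ :=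
  sSup ((fun x => (⟪T x, x⟫_ℂ).re) '' {x | x ∈ W ∧ ‖x‖ = 1})

lemma abs_re_inner_apply_le (T : E →L[ℂ] E) (x y : E) : |(⟪T x, y⟫_ℂ).re| ≤ ‖T‖ * ‖x‖ * ‖y‖ :=
  (Complex.abs_re_le_norm _).trans ((norm_inner_le_norm _ _).trans
    (by gcongr; exact T.le_opNorm x))

lemma bddAbove_re_inner_apply (T : E →L[ℂ] E) (W : Submodule ℂ E) :
    BddAbove ((fun x => (⟪T x, x⟫_ℂ).re) '' {x | x ∈ W ∧ ‖x‖ = 1}) := by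
  refine ⟨‖T‖, ?_⟩
  rintro _ ⟨x, ⟨-, hx⟩, rfl⟩
  simpa [hx] using (le_abs_self _).trans (abs_re_inner_apply_le T x x)

lemma re_inner_apply_le_topRayleigh (T : E →L[ℂ] E) {W : Submodule ℂ E} {x : E} (hx : x ∈ W) :
    (⟪T x, x⟫_ℂ).re ≤ topRayleigh T W * ‖x‖ ^ 2 := by
  rcases eq_or_ne x 0 with rfl | h0
  · simp
  have hn : 0 < ‖x‖ := norm_pos_iff.2 h0
  have h := le_csSup (bddAbove_re_inner_apply T W) (mem_image_of_mem _
    (show ((‖x‖⁻¹ : ℝ) : ℂ) • x ∈ {x | x ∈ W ∧ ‖x‖ = 1} from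
      ⟨W.smul_mem _ hx, by
        rw [norm_smul, Complex.norm_real, norm_inv, norm_norm, inv_mul_cancel₀ hn.ne']⟩))
  simp only [map_smul, inner_smul_left, inner_smul_right, Complex.conj_ofReal,
    Complex.re_ofReal_mul] at h
  change ‖x‖⁻¹ * (‖x‖⁻¹ * _) ≤ topRayleigh T W at h
  rw [← mul_assoc, ← mul_inv, inv_mul_le_iff₀ (by positivity)] at h
  rw [sq, mul_comm]; exact h

lemma nonempty_unit_of_ne_bot {W : Submodule ℂ E} (hW : W ≠ ⊥) : {x | x ∈ W ∧ ‖x‖ = 1}.Nonempty := by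
  obtain ⟨x, hx, h0⟩ := W.ne_bot_iff.1 hW
  have hn : 0 < ‖x‖ := norm_pos_iff.2 h0
  exact ⟨((‖x‖⁻¹ : ℝ) : ℂ) • x, W.smul_mem _ hx, by
    rw [norm_smul, Complex.norm_real, norm_inv, norm_norm, inv_mul_cancel₀ hn.ne']⟩

lemma abs_topRayleigh_le (T : E →L[ℂ] E) {W : Submodule ℂ E} (hW : W ≠ ⊥) :
    |topRayleigh T W| ≤ ‖T‖ := by
  have hne := nonempty_unit_of_ne_bot hW
  have hb : ∀ x : E, ‖x‖ = 1 → |(⟪T x, x⟫_ℂ).re| ≤ ‖T‖ := fun x hx => by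
    simpa [hx] using abs_re_inner_apply_le T x x
  refine abs_le.2 ⟨?_, csSup_le (hne.image _) ?_⟩
  · obtain ⟨x, hx⟩ := hne
    exact (abs_le.1 (hb x hx.2)).1.trans
      (le_csSup (bddAbove_re_inner_apply T W) (mem_image_of_mem _ hx))
  · rintro _ ⟨x, hx, rfl⟩
    exact (abs_le.1 (hb x hx.2)).2

lemma topRayleigh_le_add (T : E →L[ℂ] E) {W W' : Submodule ℂ E} (hW : W ≠ ⊥) (hW' : W' ≠ ⊥) {δ : ℝ}
    (hδ : δ ≤ 1) (h : ∀ x ∈ W, ∃ y ∈ W', ‖y - x‖ ≤ δ * ‖x‖) :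
    topRayleigh T W ≤ topRayleigh T W' + 6 * ‖T‖ * δ := by
  refine csSup_le ((nonempty_unit_of_ne_bot hW).image _) ?_
  rintro _ ⟨x, ⟨hxW, hx⟩, rfl⟩
  obtain ⟨y, hy, hyx⟩ := h x hxW
  rw [hx, mul_one] at hyx
  have hδ0 : 0 ≤ δ := (norm_nonneg _).trans hyx
  have h1 := re_inner_apply_le_topRayleigh T hy
  have h2 := abs_topRayleigh_le T hW'
  have h3 : ‖y‖ ≤ 1 + δ := by
    have := norm_le_norm_add_norm_sub' y x
    linarith
  have h4 : 1 - δ ≤ ‖y‖ := by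
    have := norm_le_norm_add_norm_sub' x y
    rw [norm_sub_rev] at this
    linarith
  have e : (⟪T x, x⟫_ℂ).re = (⟪T y, y⟫_ℂ).re - (⟪T (y - x), y⟫_ℂ).re - (⟪T x, y - x⟫_ℂ).re := by
    simp only [map_sub, inner_sub_left, inner_sub_right, Complex.sub_re]
    ring
  have h5 : |(⟪T (y - x), y⟫_ℂ).re| ≤ ‖T‖ * (2 * δ) := by
    refine (abs_re_inner_apply_le T _ _).trans ?_
    rw [mul_assoc]
    refine mul_le_mul_of_nonneg_left ?_ (norm_nonneg T)
    have := mul_le_mul hyx h3 (norm_nonneg y) hδ0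
    nlinarith
  have h6 : |(⟪T x, y - x⟫_ℂ).re| ≤ ‖T‖ * δ := by
    refine (abs_re_inner_apply_le T _ _).trans ?_
    rw [hx, mul_one]
    gcongr
  have h7 : topRayleigh T W' * ‖y‖ ^ 2 ≤ topRayleigh T W' + ‖T‖ * (3 * δ) := by
    have h8 : |‖y‖ ^ 2 - 1| ≤ 3 * δ := by
      rw [abs_le]; constructor <;> nlinarith [norm_nonneg y]
    have h9 : |topRayleigh T W' * (‖y‖ ^ 2 - 1)| ≤ ‖T‖ * (3 * δ) := by
      rw [abs_mul]; gcongr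
    have := (le_abs_self _).trans h9
    linarith
  have := (abs_le.1 h5).1
  have := (abs_le.1 h6).1
  simp only [e]
  linarith

lemma exists_norm_apply_sub_topRayleigh_smul_le (T : E →L[ℂ] E) {W : Submodule ℂ E} (hW : W ≠ ⊥)
    (hT : ∀ x y, ⟪T x, y⟫_ℂ = ⟪x, T y⟫_ℂ) {e : ℝ} (he : 0 < e)
    (h : ∀ x ∈ W, ‖x‖ = 1 → ∃ y ∈ W, ‖T x - y‖ ≤ e) :
    ∃ x ∈ W, ‖x‖ = 1 ∧ ‖T x - (topRayleigh T W : ℂ) • x‖ ≤ 4 * e := by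
  set N := topRayleigh T W with hN
  set B := ‖T‖ + 1 with hB
  have hB0 : 0 < B := by positivity
  set s := 1 / (2 * B) with hs
  have hs0 : 0 < s := by positivity
  have hsB : s * (2 * B) = 1 := by rw [hs]; field_simp
  obtain ⟨_, ⟨x, ⟨hxW, hx⟩, rfl⟩, hxN⟩ := exists_lt_of_lt_csSup
    ((nonempty_unit_of_ne_bot hW).image fun x => (⟪T x, x⟫_ℂ).re)
    (show N - s * e ^ 2 < topRayleigh T W by rw [← hN]; linarith [show 0 < s * e ^ 2 by positivity])
  obtain ⟨y, hy, hyx⟩ := h x hxW hx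
  refine ⟨x, hxW, hx, ?_⟩
  set v := (N : ℂ) • x - y with hv
  have hvW : v ∈ W := W.sub_mem (W.smul_mem _ hxW) hy
  have hz := re_inner_apply_le_topRayleigh T (W.sub_mem hxW (W.smul_mem (s : ℂ) hvW))
  rw [← hN] at hz
  have hxx : (⟪x, x⟫_ℂ).re = 1 := by
    have : (⟪x, x⟫_ℂ).re = ‖x‖ ^ 2 := inner_self_eq_norm_sq (𝕜 := ℂ) x
    rw [this, hx, one_pow]
  have hvv : (⟪v, v⟫_ℂ).re = ‖v‖ ^ 2 := inner_self_eq_norm_sq (𝕜 := ℂ) v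
  have hsymm : ∀ a b : E, (⟪a, b⟫_ℂ).re = (⟪b, a⟫_ℂ).re := fun a b => inner_re_symm (𝕜 := ℂ) a b
  have hnz : ‖x - (s : ℂ) • v‖ ^ 2 = 1 - 2 * s * (⟪x, v⟫_ℂ).re + s ^ 2 * ‖v‖ ^ 2 := by
    have : (⟪x - (s : ℂ) • v, x - (s : ℂ) • v⟫_ℂ).re = ‖x - (s : ℂ) • v‖ ^ 2 :=
      inner_self_eq_norm_sq (𝕜 := ℂ) _
    rw [← this]
    simp only [inner_sub_left, inner_sub_right, inner_smul_left, inner_smul_right,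
      Complex.conj_ofReal, Complex.sub_re, Complex.re_ofReal_mul, hxx, hvv, hsymm v x]
    ring
  have hqz : (⟪T (x - (s : ℂ) • v), x - (s : ℂ) • v⟫_ℂ).re =
      (⟪T x, x⟫_ℂ).re - 2 * s * (⟪T x, v⟫_ℂ).re + s ^ 2 * (⟪T v, v⟫_ℂ).re := by
    have : (⟪T v, x⟫_ℂ).re = (⟪T x, v⟫_ℂ).re := by rw [hT v x, hsymm]
    simp only [map_sub, map_smul, inner_sub_left, inner_sub_right, inner_smul_left,
      inner_smul_right, Complex.conj_ofReal, Complex.sub_re, Complex.re_ofReal_mul, this]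
    ring
  rw [hnz, hqz] at hz
  have hcross : ‖v‖ ^ 2 - e * ‖v‖ ≤ N * (⟪x, v⟫_ℂ).re - (⟪T x, v⟫_ℂ).re := by
    have h1 : T x - y = T x + v - (N : ℂ) • x := by rw [hv]; abel
    have h2 : (⟪T x - y, v⟫_ℂ).re ≤ e * ‖v‖ :=
      (Complex.re_le_norm _).trans ((norm_inner_le_norm _ _).trans (by gcongr))
    rw [h1, inner_sub_left, inner_add_left, inner_smul_left, Complex.conj_ofReal, Complex.sub_re,
      Complex.add_re, Complex.re_ofReal_mul, hvv] at h2
    linarith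
  have hgv : N * ‖v‖ ^ 2 - (⟪T v, v⟫_ℂ).re ≤ 2 * B * ‖v‖ ^ 2 := by
    have h1 := (abs_le.1 (abs_re_inner_apply_le T v v)).1
    have h2 := (abs_le.1 (abs_topRayleigh_le T hW)).2
    rw [← hN] at h2
    nlinarith [sq_nonneg ‖v‖, mul_le_mul_of_nonneg_right h2 (sq_nonneg ‖v‖)]
  have hfin : ‖v‖ ^ 2 ≤ e ^ 2 + 2 * e * ‖v‖ := by
    have h1 := mul_le_mul_of_nonneg_left hcross (show 0 ≤ 2 * s by positivity)
    have h2 := mul_le_mul_of_nonneg_left hgv (show 0 ≤ s ^ 2 by positivity)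
    have h3 : s ^ 2 * (2 * B * ‖v‖ ^ 2) = s * ‖v‖ ^ 2 := by
      linear_combination (s * ‖v‖ ^ 2) * hsB
    have h4 : s * ‖v‖ ^ 2 ≤ s * (e ^ 2 + 2 * e * ‖v‖) := by
      have : (⟪T x, x⟫_ℂ).re > N - s * e ^ 2 := hxN
      nlinarith
    exact le_of_mul_le_mul_left h4 hs0
  have hv3 : ‖v‖ ≤ 3 * e := by nlinarith [norm_nonneg v]
  have : T x - (N : ℂ) • x = (T x - y) - v := by rw [hv]; abel
  rw [this]
  exact (norm_sub_le _ _).trans (by linarith)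
end Rayleigh

section Spectral
open scoped InnerProductSpace ComplexConjugate

variable {X : Type*} [TopologicalSpace X]
  {E : Type*} [NormedAddCommGroup E] [InnerProductSpace ℂ E] [CompleteSpace E]

lemma exists_mem_defectSpace_norm_sub_le {π : C(X, ℂ) →⋆ₐ[ℂ] (E →L[ℂ] E)} {H : Submodule ℂ E}
    (hH : IsClosed (H : Set E)) {u F θ : C(X, ℂ)} {l : ℂ} (huH : u ∈ invariantSubalgebra π H)
    (hF : F ∈ invariantSubalgebra π H) {x : E} (hx : x ∈ defectSpace π H u l) {e : ℝ}
    (h₁ : ‖π (θ - F) x‖ ≤ e) (h₂ : ‖π (θ - star F) x‖ ≤ e) :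
    ∃ y ∈ defectSpace π H u l, ‖π θ x - y‖ ≤ 3 * e := by
  set R := H.map (π (u - algebraMap ℂ _ l)).toLinearMap with hR
  set D := R.topologicalClosure with hD
  have hRH : R ≤ H := by
    rintro _ ⟨y, hy, rfl⟩
    exact (sub_mem huH (algebraMap_mem _ l) : u - algebraMap ℂ _ l ∈ invariantSubalgebra π H) y hy
  have hDH : D ≤ H := R.topologicalClosure_minimal hRH hH
  have : CompleteSpace D := R.isClosed_topologicalClosure.completeSpace_coe
  have hFD : ∀ y ∈ D, π F y ∈ D := fun y hy => by
    refine map_mem_closure (π F).continuous hy ?_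
    rintro _ ⟨z, hz, rfl⟩
    refine ⟨π F z, hF z hz, ?_⟩
    simp only [ContinuousLinearMap.coe_coe, ← map_mul_apply, mul_comm]
  have hxR : x ∈ Dᗮ := by rw [hD, Submodule.orthogonal_closure]; exact hx.2
  set q := D.starProjection (π F x) with hq
  have hqD : q ∈ D := D.starProjection_apply_mem _
  have hy : π F x - q ∈ Dᗮ := D.sub_starProjection_mem_orthogonal _
  refine ⟨π F x - q, ⟨H.sub_mem (hF x hx.1) (hDH hqD), ?_⟩, ?_⟩
  · rw [← Submodule.orthogonal_closure]; exact hy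
  have hqq : ⟪q, π F x - π (star F) x⟫_ℂ = ⟪q, q⟫_ℂ := by
    have h3 : ⟪q, π (star F) x⟫_ℂ = 0 := by
      rw [← inner_map_apply_left]; exact hxR _ (hFD q hqD)
    have h4 : ⟪q, π F x - q⟫_ℂ = 0 := hy q hqD
    rw [inner_sub_right, h3, sub_zero]
    rw [inner_sub_right] at h4
    exact sub_eq_zero.1 h4
  have h5 : ‖π F x - π (star F) x‖ ≤ 2 * e := by
    have : π F x - π (star F) x = π (θ - star F) x - π (θ - F) x := by
      simp only [map_sub, _root_.sub_apply]; abel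
    rw [this]
    linarith [norm_sub_le (π (θ - star F) x) (π (θ - F) x)]
  have h6 : ‖q‖ * ‖q‖ ≤ ‖q‖ * (2 * e) := by
    calc ‖q‖ * ‖q‖ = ‖⟪q, q⟫_ℂ‖ := by rw [inner_self_eq_norm_sq_to_K]; simp [sq]
      _ ≤ ‖q‖ * ‖π F x - π (star F) x‖ := by rw [← hqq]; exact norm_inner_le_norm _ _
      _ ≤ _ := by gcongr
  have h7 : ‖q‖ ≤ 2 * e := by
    rcases (norm_nonneg q).eq_or_lt with h | h
    · rw [← h]; exact (norm_nonneg _).trans h5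
    · exact le_of_mul_le_mul_left h6 h
  calc ‖π θ x - (π F x - q)‖ = ‖π (θ - F) x + q‖ := by
        congr 1; simp only [map_sub, _root_.sub_apply]; abel
    _ ≤ ‖π (θ - F) x‖ + ‖q‖ := norm_add_le _ _
    _ ≤ 3 * e := by linarith

lemma norm_map_sub_apply_sq_of_mem_defectSpace {π : C(X, ℂ) →⋆ₐ[ℂ] (E →L[ℂ] E)}
    {H : Submodule ℂ E} {u : C(X, ℂ)} (hu : ∀ t, ‖u t‖ = 1) {r : ℝ} {c : ℂ} (hc : ‖c‖ = 1)
    {x : E} (hx : x ∈ defectSpace π H u (r * c)) (hx1 : ‖x‖ = 1) :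
    ‖π (u - algebraMap ℂ _ c) x‖ ^ 2 = 2 * (1 - r) := by
  have h0 := (mem_defectSpace.1 hx).2 x (mem_defectSpace.1 hx).1
  rw [map_sub, _root_.sub_apply, map_const_apply, inner_sub_left, inner_smul_left,
    inner_self_eq_norm_sq_to_K, hx1, sub_eq_zero] at h0
  have h1 : ‖π u x‖ = 1 := by
    rw [norm_map_apply_eq_of_norm_eq π (g := 1) (fun t => by simpa using hu t) x]
    simpa using hx1
  rw [map_sub, _root_.sub_apply, map_const_apply, norm_sub_sq (𝕜 := ℂ), inner_smul_right, h0,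
    norm_smul, hc, h1, hx1]
  have : c * ((starRingEnd ℂ) (r * c) * ((1 : ℝ) : ℂ) ^ 2) = (r : ℂ) := by
    rw [map_mul, Complex.conj_ofReal]
    have := Complex.mul_conj' c
    rw [hc] at this
    push_cast at this ⊢
    linear_combination (r : ℂ) * this
  erw [this]
  simp
  ring

/-- If `θ` is, up to a small error and a multiple of `|u - c|`, approximated by operators leaving
`H` invariant, then the boundary behaviour of the defect spaces would give a continuous
argument on the circle. -/
lemma defectSpace_eq_bot [CompactSpace X] {π : C(X, ℂ) →⋆ₐ[ℂ] (E →L[ℂ] E)} {H : Submodule ℂ E}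
    (hH : IsClosed (H : Set E)) {u θ : C(X, ℂ)} (huH : u ∈ invariantSubalgebra π H)
    (hθ : star θ = θ) (huθ : ∀ t, Complex.exp (Complex.I * θ t) = u t) {C : ℝ} (hC : 0 ≤ C)
    (happ : ∀ c : ℂ, ‖c‖ = 1 → ∃ F ∈ invariantSubalgebra π H,
      ∀ t, ‖θ t - F t‖ ≤ 1 / 50 + C * ‖u t - c‖) {a : ℂ} (ha : ‖a‖ < 1) :
    defectSpace π H u a = ⊥ := by
  by_contra hne
  have hθre : ∀ t, θ t = ((θ t).re : ℂ) := fun t => by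
    have := congrArg (fun f : C(X, ℂ) => f t) hθ
    exact (Complex.conj_eq_iff_re.1 this).symm
  have hu : ∀ t, ‖u t‖ = 1 := fun t => by
    rw [← huθ, hθre, mul_comm, Complex.norm_exp_ofReal_mul_I]
  have hbot : ∀ b : ℂ, ‖b‖ < 1 → defectSpace π H u b ≠ ⊥ := fun b hb => by
    obtain ⟨x, hx, hx0⟩ := (Submodule.ne_bot_iff _).1 hne
    obtain ⟨y, hy, -, hy0⟩ := exists_mem_defectSpace_near hH hu huH ha hb hx
    exact (Submodule.ne_bot_iff _).2 ⟨y, hy, hy0 hx0⟩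
  set κ : ℝ := 1 / (1 + 12 * C) with hκ
  have hκ0 : 0 < κ := by positivity
  have hκ1 : κ ≤ 1 := by rw [hκ, div_le_one (by positivity)]; linarith
  have hκC : κ + 12 * C * κ = 1 := by rw [hκ]; field_simp
  set r : ℝ := 1 - κ ^ 2 / 2 with hr
  have hr0 : 0 ≤ r := by nlinarith
  have hr1 : r < 1 := by rw [hr]; nlinarith [sq_nonneg κ, mul_pos hκ0 hκ0]
  set cc : ℝ → ℂ := fun t => Complex.exp (t * Complex.I) with hcc
  have hcn : ∀ t, ‖cc t‖ = 1 := fun t => Complex.norm_exp_ofReal_mul_I t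
  have hrc : ∀ t, ‖(r : ℂ) * cc t‖ = r := fun t => by
    rw [norm_mul, hcn, Complex.norm_real, Real.norm_of_nonneg hr0, mul_one]
  set N : ℝ → ℝ := fun t => topRayleigh (π θ) (defectSpace π H u (r * cc t)) with hN
  -- continuity
  have hle : ∀ s t : ℝ, ‖(r : ℂ) * cc s - r * cc t‖ / (1 - r) ≤ 1 →
      N s ≤ N t + 6 * ‖π θ‖ * (‖(r : ℂ) * cc s - r * cc t‖ / (1 - r)) := fun s t hst => by
    refine topRayleigh_le_add _ (hbot _ (by rw [hrc]; exact hr1)) (hbot _ (by rw [hrc]; exact hr1))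
      hst fun x hx => ?_
    obtain ⟨y, hy, hyx, -⟩ := exists_mem_defectSpace_near hH hu huH
      (by rw [hrc]; exact hr1) (by rw [hrc]; exact hr1) (b := r * cc t) hx
    exact ⟨y, hy, by rwa [hrc] at hyx⟩
  have hNc : Continuous N := by
    rw [continuous_iff_continuousAt]
    intro t
    have hcont : Continuous fun s => ‖(r : ℂ) * cc s - r * cc t‖ / (1 - r) := by
      simp only [hcc]; fun_prop
    have h0 : Filter.Tendsto (fun s => ‖(r : ℂ) * cc s - r * cc t‖ / (1 - r)) (nhds t) (nhds 0) := by
      simpa using hcont.tendsto t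
    have h1 := h0.const_mul (6 * ‖π θ‖)
    rw [mul_zero] at h1
    rw [ContinuousAt, tendsto_iff_dist_tendsto_zero]
    refine squeeze_zero' (Filter.Eventually.of_forall fun _ => dist_nonneg) ?_ h1
    filter_upwards [h0.eventually (Iic_mem_nhds zero_lt_one)] with s hs
    rw [Real.dist_eq, abs_le]
    have h2 := hle s t hs
    have h3 := hle t s (by rwa [norm_sub_rev])
    rw [norm_sub_rev] at h3
    constructor <;> linarith
  -- the approximate eigenvalue is close to the argument
  have hclose : ∀ t, Complex.exp (Complex.I * N t) ≠ -cc t := by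
    intro t hexp
    set W := defectSpace π H u (r * cc t) with hW
    obtain ⟨F, hF, hFθ⟩ := happ (cc t) (hcn t)
    have huc : ∀ x ∈ W, ‖x‖ = 1 → ‖π (u - algebraMap ℂ _ (cc t)) x‖ = κ := fun x hx hx1 => by
      have := norm_map_sub_apply_sq_of_mem_defectSpace hu (hcn t) hx hx1
      rw [show 2 * (1 - r) = κ ^ 2 by rw [hr]; ring] at this
      exact (pow_left_inj₀ (norm_nonneg _) hκ0.le two_ne_zero).1 this
    have hb : ∀ f : C(X, ℂ), (∀ s, ‖f s‖ ≤ 1 / 50 + C * ‖u s - cc t‖) → ∀ x ∈ W, ‖x‖ = 1 →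
        ‖π f x‖ ≤ 1 / 50 + C * κ := fun f hf x hx hx1 => by
      have := norm_map_apply_le_add π (g := u - algebraMap ℂ _ (cc t)) (by norm_num) hC hf x
      rwa [huc x hx hx1, hx1, mul_one] at this
    obtain ⟨x, hx, hx1, hxN⟩ := exists_norm_apply_sub_topRayleigh_smul_le (π θ)
      (hbot _ (by rw [hrc]; exact hr1) : W ≠ ⊥)
      (fun x y => by rw [inner_map_apply_left, hθ]) (e := 3 * (1 / 50 + C * κ)) (by positivity)
      (fun x hx hx1 => exists_mem_defectSpace_norm_sub_le hH huH hF hx (hb _ hFθ x hx hx1)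
        (hb _ (fun s => by
          have h : ‖(θ - star F) s‖ = ‖star (θ s - F s)‖ := by
            rw [star_sub]
            congr 1
            simp only [ContinuousMap.sub_apply, ContinuousMap.star_apply]
            rw [hθre]; simp
          rw [h, norm_star]; exact hFθ s) x hx hx1))
    change ‖π θ x - (N t : ℂ) • x‖ ≤ _ at hxN
    have h1 : ‖π (u - algebraMap ℂ _ (Complex.exp (Complex.I * N t))) x‖ ≤
        ‖π θ x - (N t : ℂ) • x‖ := by
      rw [← map_const_apply π, ← _root_.sub_apply, ← map_sub]
      refine norm_map_apply_le_of_norm_le π (fun s => ?_) x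
      simp only [ContinuousMap.sub_apply, _root_.algebraMap_apply, smul_eq_mul, mul_one]
      rw [← huθ, hθre, show Complex.I * (((θ s).re : ℝ) : ℂ) =
        Complex.I * ((((θ s).re - N t : ℝ)) : ℂ) + Complex.I * N t by push_cast; ring,
        Complex.exp_add, ← sub_one_mul, norm_mul, mul_comm Complex.I (N t : ℂ),
        Complex.norm_exp_ofReal_mul_I, mul_one, ← Complex.ofReal_sub, Complex.norm_real]
      exact Real.norm_exp_I_mul_ofReal_sub_one_le
    have h2 : (2 : ℝ) ≤ ‖π (u - algebraMap ℂ _ (cc t)) x‖ +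
        ‖π (u - algebraMap ℂ _ (Complex.exp (Complex.I * N t))) x‖ := by
      have h3 : (-(2 * cc t)) • x = π (u - algebraMap ℂ _ (cc t)) x -
          π (u - algebraMap ℂ _ (Complex.exp (Complex.I * N t))) x := by
        rw [hexp, map_sub, map_sub, _root_.sub_apply, _root_.sub_apply, map_const_apply,
          map_const_apply]
        module
      have h4 : ‖(-(2 * cc t)) • x‖ = 2 := by simp [norm_smul, hcn, hx1]
      rw [← h4, h3]
      exact norm_sub_le _ _
    rw [huc x hx hx1] at h2
    nlinarith
  -- winding number contradiction
  have hper : N (2 * Real.pi) = N 0 := by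
    simp only [hN, hcc]
    push_cast
    rw [Complex.exp_two_pi_mul_I]
    simp
  have hpi := Real.pi_pos
  set f : ℝ → ℝ := fun t => N t - t - Real.pi with hf
  set k : ℤ := ⌊f 0 / (2 * Real.pi)⌋ with hk
  have hk1 : (k : ℝ) * (2 * Real.pi) ≤ f 0 := (le_div_iff₀ (by positivity)).1 (Int.floor_le _)
  have hk2 : f 0 < (k + 1 : ℝ) * (2 * Real.pi) :=
    (div_lt_iff₀ (by positivity)).1 (Int.lt_floor_add_one _)
  have hf2 : f (2 * Real.pi) = f 0 - 2 * Real.pi := by simp only [hf, hper]; ring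
  obtain ⟨t, -, ht⟩ := intermediate_value_Icc' (f := f) (a := 0) (b := 2 * Real.pi) (by positivity)
    (by simp only [hf]; fun_prop) (show (k : ℝ) * (2 * Real.pi) ∈ _ from ⟨by rw [hf2]; linarith, hk1⟩)
  refine hclose t ?_
  have : N t = t + Real.pi + k * (2 * Real.pi) := by simp only [hf] at ht; linarith
  rw [this]
  push_cast
  rw [show Complex.I * ((t : ℂ) + Real.pi + k * (2 * Real.pi)) =
    t * Complex.I + Real.pi * Complex.I + k * (2 * Real.pi * Complex.I) by ring, Complex.exp_add,
    Complex.exp_int_mul_two_pi_mul_I, Complex.exp_add, Complex.exp_pi_mul_I]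
  simp [hcc]

end Spectral

section State
open scoped InnerProductSpace ComplexConjugate ComplexOrder

variable {X : Type*} [TopologicalSpace X]

lemma exists_positiveLinearMap_eq [CompactSpace X] (φ : C(X, ℂ) →L[ℂ] ℂ) (hφ : ‖φ‖ ≤ 1)
    (h1 : φ 1 = 1) : ∃ f : C(X, ℂ) →ₚ[ℂ] ℂ, ∀ g, f g = φ g := by
  refine ⟨PositiveLinearMap.mk₀ (φ : C(X, ℂ) →ₗ[ℂ] ℂ) fun g hg => ?_, fun _ => rfl⟩
  change 0 ≤ φ g
  set M := ‖g‖ with hM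
  have hM0 : 0 ≤ M := norm_nonneg _
  have hg' : ∀ x, g x = ((g x).re : ℂ) ∧ 0 ≤ (g x).re ∧ (g x).re ≤ M := fun x => by
    obtain ⟨hre, him⟩ := Complex.nonneg_iff.1 (ContinuousMap.le_def.1 hg x)
    exact ⟨Complex.ext rfl him.symm, hre,
      (Complex.re_le_norm _).trans (g.norm_coe_le_norm x)⟩
  have key : ∀ t : ℝ, (φ g).re ^ 2 + (φ g).im ^ 2 - M * (φ g).re ≤ 2 * t * (φ g).im := fun t => by
    have h2 : ‖φ (g - algebraMap ℂ _ (⟨M / 2, t⟩ : ℂ))‖ ≤ Real.sqrt ((M / 2) ^ 2 + t ^ 2) := by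
      refine (φ.le_of_opNorm_le hφ _).trans ?_
      rw [one_mul, ContinuousMap.norm_le _ (Real.sqrt_nonneg _)]
      intro x
      obtain ⟨hx, hx0, hxM⟩ := hg' x
      rw [Complex.norm_eq_sqrt_sq_add_sq]
      refine Real.sqrt_le_sqrt ?_
      rw [ContinuousMap.sub_apply, hx]
      simp
      nlinarith
    rw [map_sub, Algebra.algebraMap_eq_smul_one, map_smul, h1, Complex.norm_eq_sqrt_sq_add_sq,
      Real.sqrt_le_sqrt_iff (by positivity)] at h2
    simp at h2
    nlinarith
  have him : (φ g).im = 0 := by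
    by_contra h
    have := key (((φ g).re ^ 2 + (φ g).im ^ 2 - M * (φ g).re - 1) / (2 * (φ g).im))
    rw [show 2 * (((φ g).re ^ 2 + (φ g).im ^ 2 - M * (φ g).re - 1) / (2 * (φ g).im)) * (φ g).im =
      (φ g).re ^ 2 + (φ g).im ^ 2 - M * (φ g).re - 1 by field_simp] at this
    linarith
  have := key 0
  rw [him] at this
  refine Complex.nonneg_iff.2 ⟨?_, him.symm⟩
  by_contra! h
  nlinarith

lemma exists_continuousLinearMap_comp_eq [CompactSpace X] {R : Type*} [CommRing R] [Algebra ℂ R]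
    (ρ : R →ₐ[ℂ] C(X, ℂ)) (χ : R →ₐ[ℂ] ℂ) (hχ : ∀ p, ‖χ p‖ ≤ ‖ρ p‖) :
    ∃ φ : C(X, ℂ) →L[ℂ] ℂ, ‖φ‖ ≤ 1 ∧ ∀ p, φ (ρ p) = χ p := by
  have hker : LinearMap.ker ρ.toLinearMap ≤ LinearMap.ker χ.toLinearMap := fun p hp => by
    have h : ρ p = 0 := hp
    have := hχ p
    rw [h, norm_zero] at this
    exact norm_le_zero_iff.1 this
  let l : LinearMap.range ρ.toLinearMap →ₗ[ℂ] ℂ :=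
    ((LinearMap.ker ρ.toLinearMap).liftQ χ.toLinearMap hker).comp
      ρ.toLinearMap.quotKerEquivRange.symm.toLinearMap
  have hl : ∀ p, l ⟨ρ p, p, rfl⟩ = χ p := fun p => by
    exact congrArg ((LinearMap.ker ρ.toLinearMap).liftQ χ.toLinearMap hker)
      (ρ.toLinearMap.quotKerEquivRange_symm_apply_image p (LinearMap.mem_range_self _ p))
  have hb : ∀ x, ‖l x‖ ≤ 1 * ‖x‖ := by
    rintro ⟨_, p, rfl⟩
    rw [one_mul]
    exact (congrArg norm (hl p)).le.trans (hχ p)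
  obtain ⟨φ, hφ, hn⟩ := exists_extension_norm_eq _ (l.mkContinuous 1 hb)
  exact ⟨φ, hn.le.trans (l.mkContinuous_norm_le zero_le_one hb),
    fun p => (hφ ⟨ρ p, p, rfl⟩).trans (hl p)⟩

/-- A character bounded by the uniform norm has modulus at least one on a unimodular function with a
continuous argument that is approximable along the level sets of that function. -/
lemma one_le_norm_character [CompactSpace X] {R : Type*} [CommRing R] [Algebra ℂ R]
    (ρ : R →ₐ[ℂ] C(X, ℂ)) (χ : R →ₐ[ℂ] ℂ) (hχ : ∀ p, ‖χ p‖ ≤ ‖ρ p‖) {θ : C(X, ℂ)}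
    (hθ : star θ = θ) {P : R} (huθ : ∀ t, Complex.exp (Complex.I * θ t) = ρ P t) {C : ℝ}
    (hC : 0 ≤ C) (happ : ∀ c : ℂ, ‖c‖ = 1 → ∃ p : R,
      ∀ t, ‖θ t - ρ p t‖ ≤ 1 / 50 + C * ‖ρ P t - c‖) : 1 ≤ ‖χ P‖ := by
  by_contra! hlt
  obtain ⟨φ, hφ, hφχ⟩ := exists_continuousLinearMap_comp_eq ρ χ hχ
  obtain ⟨f, hf⟩ := exists_positiveLinearMap_eq φ hφ (by simpa using hφχ 1)
  let π := f.gnsStarAlgHom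
  let ι : C(X, ℂ) →ₗ[ℂ] f.GNS :=
    (UniformSpace.Completion.toComplₗᵢ (𝕜 := ℂ) (E := f.PreGNS)).toLinearMap ∘ₗ
      f.toPreGNS.toLinearMap
  have hπι : ∀ g h, π g (ι h) = ι (g * h) := fun g h => by
    change f.gnsNonUnitalStarAlgHom g ((f.toPreGNS h : f.PreGNS) : f.GNS) = _
    rw [PositiveLinearMap.gnsNonUnitalStarAlgHom_apply_coe]
    rfl
  have hin : ∀ g, ⟪ι 1, ι g⟫_ℂ = f g := fun g => by
    change ⟪((f.toPreGNS 1 : f.PreGNS) : f.GNS), ((f.toPreGNS g : f.PreGNS) : f.GNS)⟫_ℂ = _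
    rw [UniformSpace.Completion.inner_coe, PositiveLinearMap.preGNS_inner_def]
    simp
  let H := (LinearMap.range (ι ∘ₗ ρ.toLinearMap)).topologicalClosure
  have hH : IsClosed (H : Set f.GNS) := Submodule.isClosed_topologicalClosure _
  have hinv : ∀ p, ρ p ∈ invariantSubalgebra π H := fun p x hx => by
    refine map_mem_closure (π (ρ p)).continuous hx ?_
    rintro _ ⟨q, rfl⟩
    exact ⟨p * q, by simp [hπι]⟩
  have hbot := defectSpace_eq_bot hH (hinv P) hθ huθ hC (fun c hc => by
    obtain ⟨p, hp⟩ := happ c hc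
    exact ⟨ρ p, hinv p, hp⟩) hlt
  have hmem : ι 1 ∈ defectSpace π H (ρ P) (χ P) := by
    refine mem_defectSpace.2 ⟨Submodule.le_topologicalClosure _ ⟨1, by simp⟩, fun y hy => ?_⟩
    rw [inner_eq_zero_symm]
    refine closure_minimal (t := {y | ⟪ι 1, π (ρ P - algebraMap ℂ _ (χ P)) y⟫_ℂ = 0}) ?_
      (isClosed_eq (by fun_prop) continuous_const) hy
    rintro _ ⟨q, rfl⟩
    have : ρ P - algebraMap ℂ _ (χ P) = ρ (P - algebraMap ℂ _ (χ P)) := by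
      rw [map_sub, AlgHom.commutes]
    simp only [Set.mem_ofPred_eq, LinearMap.comp_apply, AlgHom.toLinearMap_apply]
    rw [hπι, this, ← map_mul, hin, hf, hφχ, map_mul, map_sub, AlgHom.commutes]
    simp
  rw [hbot, Submodule.mem_bot] at hmem
  have := hin 1
  rw [hmem, inner_zero_left, hf, ← map_one ρ, hφχ, map_one] at this
  exact zero_ne_one this

end State

section Uniformity

variable {X : Type*} [TopologicalSpace X]

lemma exists_forall_norm_le_add_mul [CompactSpace X] {f g : X → ℝ} (hf : Continuous f)
    (hg : Continuous g) (hg0 : ∀ t, 0 ≤ g t) {e : ℝ} (he : 0 ≤ e) (h : ∀ t, g t = 0 → f t < e) :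
    ∃ C, 0 ≤ C ∧ ∀ t, f t ≤ e + C * g t := by
  have hS : IsCompact {t | e ≤ f t} := (isClosed_le continuous_const hf).isCompact
  have hne : ∀ t ∈ {t | e ≤ f t}, g t ≠ 0 := fun t ht h0 => (h t h0).not_ge ht
  obtain ⟨C, hC⟩ := hS.exists_bound_of_continuousOn
    (hf.continuousOn.div hg.continuousOn hne)
  refine ⟨max C 0, le_max_right _ _, fun t => ?_⟩
  have hCg : 0 ≤ max C 0 * g t := mul_nonneg (le_max_right _ _) (hg0 t)
  rcases le_or_gt e (f t) with ht | ht
  · have h1 := (le_abs_self _).trans ((hC t ht).trans (le_max_left C 0))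
    rw [Pi.div_apply, div_le_iff₀ ((hg0 t).lt_of_ne' (hne t ht))] at h1
    linarith
  · linarith

lemma exists_uniform_norm_sub_le [CompactSpace X] {R : Type*} {ρ : R → C(X, ℂ)} {θ u : C(X, ℂ)}
    {e : ℝ} (he : 0 < e)
    (h : ∀ c : ℂ, ‖c‖ = 1 → ∃ p, ∀ t, u t = c → ‖θ t - ρ p t‖ < e) :
    ∃ C, 0 ≤ C ∧ ∀ c : ℂ, ‖c‖ = 1 → ∃ p, ∀ t, ‖θ t - ρ p t‖ ≤ 2 * e + C * ‖u t - c‖ := by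
  have h' : ∀ c : ℂ, ∃ p, ∃ C, 0 ≤ C ∧ (‖c‖ = 1 → ∀ t, ‖θ t - ρ p t‖ ≤ e + C * ‖u t - c‖) := by
    intro c
    by_cases hc : ‖c‖ = 1
    · obtain ⟨p, hp⟩ := h c hc
      obtain ⟨C, hC, hCp⟩ := exists_forall_norm_le_add_mul (f := fun t => ‖θ t - ρ p t‖)
        (g := fun t => ‖u t - c‖) (by fun_prop) (by fun_prop) (fun t => norm_nonneg _) he.le
        (fun t ht => hp t (sub_eq_zero.1 (norm_eq_zero.1 ht)))
      exact ⟨p, C, hC, fun _ => hCp⟩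
    · obtain ⟨p, -⟩ := h 1 (by simp)
      exact ⟨p, 0, le_rfl, fun h => absurd h hc⟩
  choose p C hC hCp using h'
  obtain ⟨s, hs, hcov⟩ := (isCompact_sphere (0 : ℂ) 1).elim_nhds_subcover
    (fun c => Metric.ball c (e / (C c + 1)))
    (fun c _ => Metric.ball_mem_nhds c (div_pos he (by linarith [hC c])))
  refine ⟨∑ c ∈ s, C c, Finset.sum_nonneg fun c _ => hC c, fun c hc => ?_⟩
  obtain ⟨d, hd, hcd⟩ := mem_iUnion₂.1 (hcov (by simpa using hc : c ∈ Metric.sphere (0 : ℂ) 1))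
  refine ⟨p d, fun t => ?_⟩
  have hd1 : C d ≤ ∑ c ∈ s, C c := Finset.single_le_sum (fun c _ => hC c) hd
  have hd2 : C d * ‖c - d‖ ≤ e := by
    rw [Metric.mem_ball, dist_eq_norm, lt_div_iff₀ (by linarith [hC d])] at hcd
    nlinarith [norm_nonneg (c - d)]
  have hd3 : ‖u t - d‖ ≤ ‖u t - c‖ + ‖c - d‖ := norm_sub_le_norm_sub_add_norm_sub _ _ _
  have h1 := hCp d (by simpa using hs d hd) t
  have h2 : C d * ‖u t - d‖ ≤ C d * ‖u t - c‖ + C d * ‖c - d‖ := by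
    rw [← mul_add]; exact mul_le_mul_of_nonneg_left hd3 (hC d)
  have h3 : C d * ‖u t - c‖ ≤ (∑ c ∈ s, C c) * ‖u t - c‖ := by gcongr
  linarith

end Uniformity

section Hull

lemma subset_polyHull {K : Set (Fin 2 → ℂ)} (hK : IsCompact K) : K ⊆ polyHull 2 K :=
  fun _ hz p => le_csSup (bddAbove_norm_eval_image hK p) (mem_image_of_mem _ hz)

lemma nonempty_of_mem_polyHull {K : Set (Fin 2 → ℂ)} {z : Fin 2 → ℂ} (hz : z ∈ polyHull 2 K) :
    K.Nonempty := by
  by_contra! h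
  have := hz 1
  norm_num [h] at this

lemma norm_eval_le_of_mem_polyHull {K : Set (Fin 2 → ℂ)} {z : Fin 2 → ℂ} (hz : z ∈ polyHull 2 K)
    {p : MvPolynomial (Fin 2) ℂ} {C : ℝ} (h : ∀ w ∈ K, ‖MvPolynomial.eval w p‖ ≤ C) :
    ‖MvPolynomial.eval z p‖ ≤ C :=
  (hz p).trans (csSup_le ((nonempty_of_mem_polyHull hz).image _) (by
    rintro _ ⟨w, hw, rfl⟩; exact h w hw))

/-- A point of the hull where `P` peaks lies in the hull of the corresponding fibre. -/
lemma mem_polyHull_fiber {K : Set (Fin 2 → ℂ)} (hK : IsCompact K) {P : MvPolynomial (Fin 2) ℂ}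
    (hP : ∀ w ∈ K, ‖MvPolynomial.eval w P‖ ≤ 1) {z : Fin 2 → ℂ} (hz : z ∈ polyHull 2 K)
    (hPz : ‖MvPolynomial.eval z P‖ = 1) :
    z ∈ polyHull 2 ({w | MvPolynomial.eval w P = MvPolynomial.eval z P} ∩ K) := by
  set c := MvPolynomial.eval z P with hc
  set L := {w | MvPolynomial.eval w P = c} ∩ K with hL
  have hLK : L ⊆ K := inter_subset_right
  intro p
  set S := sSup ((fun w => ‖MvPolynomial.eval w p‖) '' L) with hS
  have hS0 : 0 ≤ S := Real.sSup_nonneg (by rintro _ ⟨w, -, rfl⟩; exact norm_nonneg _)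
  have hcc : starRingEnd ℂ c * c = 1 := by rw [Complex.conj_mul', hPz]; simp
  let Q : MvPolynomial (Fin 2) ℂ :=
    MvPolynomial.C (1 / 2) * (1 + MvPolynomial.C (starRingEnd ℂ c) * P)
  have hQ : ∀ w, MvPolynomial.eval w Q = 1 / 2 * (1 + starRingEnd ℂ c * MvPolynomial.eval w P) :=
    fun w => by simp [Q]
  have hQz : MvPolynomial.eval z Q = 1 := by rw [hQ, ← hc, hcc]; norm_num
  have hcn : ∀ w ∈ K, ‖starRingEnd ℂ c * MvPolynomial.eval w P‖ ≤ 1 := fun w hw => by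
    rw [norm_mul, RCLike.norm_conj, hPz, one_mul]; exact hP w hw
  have hQle : ∀ w ∈ K, ‖MvPolynomial.eval w Q‖ ≤ 1 := fun w hw => by
    have := norm_add_le 1 (starRingEnd ℂ c * MvPolynomial.eval w P)
    have h2 := hcn w hw
    rw [hQ, norm_mul]
    norm_num at this h2 ⊢
    linarith
  have hQlt : ∀ w ∈ K, w ∉ L → ‖MvPolynomial.eval w Q‖ < 1 := fun w hw hwL => by
    refine (hQle w hw).lt_of_ne fun h => hwL ⟨?_, hw⟩
    have h2 := hcn w hw
    set v := starRingEnd ℂ c * MvPolynomial.eval w P with hv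
    have hv1 : v = 1 := by
      rw [hQ, ← hv] at h
      have h3 : ‖1 + v‖ ^ 2 = 4 := by
        rw [norm_mul] at h; norm_num at h
        have : ‖1 + v‖ = 2 := by linarith
        rw [this]; norm_num
      have h4 : ‖v‖ ^ 2 ≤ 1 := pow_le_one₀ (norm_nonneg _) h2
      rw [← Complex.normSq_eq_norm_sq, Complex.normSq_apply] at h3 h4
      simp at h3
      apply Complex.ext
      · simp; nlinarith [sq_nonneg (v.re - 1), sq_nonneg v.im]
      · simp; nlinarith [sq_nonneg (v.re - 1), sq_nonneg v.im]
    change MvPolynomial.eval w P = c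
    linear_combination c * hv1 + c * hv - MvPolynomial.eval w P * hcc
  refine le_of_forall_pos_le_add fun e he => ?_
  have hB : IsCompact {w | w ∈ K ∧ S + e ≤ ‖MvPolynomial.eval w p‖} :=
    hK.inter_right (isClosed_le continuous_const (MvPolynomial.continuous_eval p).norm)
  have hBL : ∀ w ∈ {w | w ∈ K ∧ S + e ≤ ‖MvPolynomial.eval w p‖}, w ∉ L := fun w hw hwL => by
    have : ‖MvPolynomial.eval w p‖ ≤ S :=
      le_csSup ((bddAbove_norm_eval_image hK p).mono (image_mono hLK)) (mem_image_of_mem _ hwL)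
    linarith [hw.2]
  obtain ⟨q, hq0, hq1, hq⟩ : ∃ q : ℝ, 0 ≤ q ∧ q < 1 ∧
      ∀ w ∈ {w | w ∈ K ∧ S + e ≤ ‖MvPolynomial.eval w p‖}, ‖MvPolynomial.eval w Q‖ ≤ q := by
    rcases eq_empty_or_nonempty {w | w ∈ K ∧ S + e ≤ ‖MvPolynomial.eval w p‖} with h | h
    · exact ⟨0, le_rfl, one_pos, by rw [h]; simp⟩
    · obtain ⟨w₀, hw₀, hmax⟩ := hB.exists_isMaxOn h
        (MvPolynomial.continuous_eval Q).norm.continuousOn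
      exact ⟨_, norm_nonneg _, hQlt w₀ hw₀.1 (hBL w₀ hw₀), fun w hw => hmax hw⟩
  obtain ⟨T, hT⟩ := bddAbove_norm_eval_image hK p
  have hlim : Filter.Tendsto (fun n => max T 0 * q ^ n) Filter.atTop (nhds 0) := by
    simpa using (tendsto_pow_atTop_nhds_zero_of_lt_one hq0 hq1).const_mul (max T 0)
  obtain ⟨n, hn⟩ := (hlim.eventually (Iic_mem_nhds he)).exists
  have := norm_eval_le_of_mem_polyHull hz (p := p * Q ^ n) (C := S + e) fun w hw => by
    rw [map_mul, map_pow, norm_mul, norm_pow]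
    rcases le_or_gt (S + e) ‖MvPolynomial.eval w p‖ with h | h
    · calc _ ≤ max T 0 * q ^ n := by
            gcongr
            · exact (hT (mem_image_of_mem _ hw)).trans (le_max_left _ _)
            · exact hq w ⟨hw, h⟩
        _ ≤ S + e := by
            have : max T 0 * q ^ n ≤ e := hn
            linarith
    · calc _ ≤ ‖MvPolynomial.eval w p‖ * 1 := by
            gcongr
            exact pow_le_one₀ (norm_nonneg _) (hQle w hw)
        _ ≤ S + e := by linarith
  rwa [map_mul, map_pow, hQz, one_pow, mul_one] at this

/-- A real argument of a unimodular function takes finitely many values on a compact fibre. -/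
lemma finite_image_of_exp_eq {Y : Type*} [TopologicalSpace Y] {L : Set Y} (hL : IsCompact L)
    {θ : Y → ℝ} (hθ : ContinuousOn θ L) {c : ℂ}
    (h : ∀ z ∈ L, Complex.exp (Complex.I * θ z) = c) : (θ '' L).Finite := by
  rcases L.eq_empty_or_nonempty with rfl | ⟨z₀, hz₀⟩
  · simp
  obtain ⟨B, hB⟩ := hL.exists_bound_of_continuousOn hθ
  have hpi := Real.pi_pos
  refine ((finite_Icc (⌈-(2 * B)⌉ : ℤ) ⌊2 * B⌋).image
    fun k : ℤ => θ z₀ + k * (2 * Real.pi)).subset ?_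
  rintro _ ⟨z, hz, rfl⟩
  obtain ⟨k, hk⟩ := Complex.exp_eq_exp_iff_exists_int.1 ((h z hz).trans (h z₀ hz₀).symm)
  have hk' : θ z = θ z₀ + k * (2 * Real.pi) := by
    have : Complex.I * (θ z : ℂ) = Complex.I * ((θ z₀ + k * (2 * Real.pi) : ℝ) : ℂ) := by
      rw [hk]; push_cast; ring
    exact_mod_cast mul_left_cancel₀ Complex.I_ne_zero this
  refine ⟨k, ?_, hk'.symm⟩
  have h1 := abs_le.1 (hB z hz)
  have h2 := abs_le.1 (hB z₀ hz₀)
  have h3 : |(k : ℝ)| ≤ 2 * B := by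
    have h4 : |(k : ℝ)| * (2 * Real.pi) ≤ 2 * B := by
      rw [← abs_of_pos (show 0 < 2 * Real.pi by positivity), ← abs_mul, abs_le]
      constructor <;> linarith
    nlinarith [abs_nonneg (k : ℝ), Real.pi_gt_three]
  exact ⟨Int.ceil_le.2 (abs_le.1 h3).1, Int.le_floor.2 (abs_le.1 h3).2⟩

end Hull

end Helpers

/-- Let `P` be a holomorphic polynomial on `ℂ²`,
`M := {z : |P z| = 1}` with `dP ≠ 0` on `M`, and `K ⊆ M` compact and
simply-coconnected. If `P⁻¹{c} ∩ K` is polynomially convex for every `c` in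
the unit circle, then `K` is polynomially convex. -/
theorem simplyCoconnected_compact_in_modulus_one_levelSet_polyConvex
    (P : MvPolynomial (Fin 2) ℂ)
    (M : Set (Fin 2 → ℂ)) (hM : M = {z | ‖MvPolynomial.eval z P‖ = 1})
    (hdP : ∀ z ∈ M, fderiv ℂ (fun w => MvPolynomial.eval w P) z ≠ 0)
    (K : Set (Fin 2 → ℂ)) (hKM : K ⊆ M) (hKc : IsCompact K)
    (hsc : SimplyCoconnected 2 K)
    (hfib : ∀ c : ℂ, ‖c‖ = 1 →
      PolyConvex 2 ({z | MvPolynomial.eval z P = c} ∩ K)) :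
    PolyConvex 2 K := by
  have hP1 : ∀ w ∈ K, ‖MvPolynomial.eval w P‖ = 1 := fun w hw => by
    have := hKM hw
    rwa [hM] at this
  have : CompactSpace K := isCompact_iff_compactSpace.1 hKc
  refine Set.Subset.antisymm (fun z hz => ?_) (subset_polyHull hKc)
  suffices h : ‖MvPolynomial.eval z P‖ = 1 by
    have := mem_polyHull_fiber hKc (fun w hw => (hP1 w hw).le) hz h
    rw [hfib _ h] at this
    exact this.2
  refine (norm_eval_le_of_mem_polyHull hz fun w hw => (hP1 w hw).le).antisymm ?_
  obtain ⟨ψ, hψ, hPψ⟩ := hsc (fun w => MvPolynomial.eval w P)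
    (MvPolynomial.continuous_eval P).continuousOn
    (fun w hw h => by simpa [h] using hP1 w hw)
  have hθc : ContinuousOn (fun w => (ψ w).im) K := Complex.continuous_im.comp_continuousOn hψ
  have hPθ : ∀ w ∈ K, Complex.exp (Complex.I * ((ψ w).im : ℝ)) = MvPolynomial.eval w P := by
    intro w hw
    have h1 := hP1 w hw
    rw [hPψ w hw, Complex.norm_exp, Real.exp_eq_one_iff] at h1
    rw [hPψ w hw]
    congr 1
    apply Complex.ext <;> simp [h1]
  let θ : C(K, ℂ) := ⟨fun w => (((ψ w).im : ℝ) : ℂ),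
    Complex.continuous_ofReal.comp (continuousOn_iff_continuous_domRestrict.1 hθc)⟩
  obtain ⟨C, hC, happ⟩ := exists_uniform_norm_sub_le (ρ := polyRestrict K) (θ := θ)
    (u := polyRestrict K P) (e := 1 / 100) (by norm_num) fun c hc => by
    have hL : IsCompact ({w | MvPolynomial.eval w P = c} ∩ K) :=
      hKc.inter_left (isClosed_singleton.preimage (MvPolynomial.continuous_eval P))
    have hLc := hθc.mono (Set.inter_subset_right (s := {w | MvPolynomial.eval w P = c}))
    obtain ⟨p, hp⟩ := exists_mvPolynomial_approx_of_finite_image hL (hfib c hc).subset hLc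
      (finite_image_of_exp_eq hL hLc fun w hw => (hPθ w hw.2).trans hw.1)
      (show (0 : ℝ) < 1 / 100 by norm_num)
    refine ⟨p, fun t ht => ?_⟩
    rw [polyRestrict_apply] at ht ⊢
    exact hp t.1 ⟨ht, t.2⟩
  have haeval : ∀ p, MvPolynomial.aeval z p = MvPolynomial.eval z p := fun p => by
    rw [← MvPolynomial.coe_aeval_eq_eval]; rfl
  rw [← haeval]
  exact one_le_norm_character (polyRestrict K) (MvPolynomial.aeval z)
    (fun p => by
      rw [haeval]
      exact norm_eval_le_of_mem_polyHull hz fun w hw =>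
        (polyRestrict_apply K p ⟨w, hw⟩ ▸ (polyRestrict K p).norm_coe_le_norm ⟨w, hw⟩))
    (θ := θ) (by ext t; exact Complex.conj_ofReal _) (P := P) (fun t => by rw [polyRestrict_apply]; exact hPθ t.1 t.2) hC
    (fun c hc => by
      obtain ⟨p, hp⟩ := happ c hc
      exact ⟨p, fun t => (hp t).trans (by norm_num)⟩)
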